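/- arXiv:math/0402377 — 2 statements merged into one kernel-verified Lean document; each statement's English description precedes it below -/
import Mathlib

section
/- Let (W,S) be a Coxeter system with S finite, and let W(t) := Σ_{w∈W} t^{ℓ(w)} ∈ ℤ[[t]] be its growth series. Then W(t) is a rational power series: there exist polynomials f, g ∈ ℤ[t] with g(0) = 1 such that g·W(t) = f in ℤ[[t]]. -/
namespace CoxeterSystem

variable {B W : Type*} [Group W] {M : CoxeterMatrix B} (cs : CoxeterSystem M W)

/-! ### The exchange condition -/

open Classical in
/-- The action of a simple reflection on pairs of a group element and a sign: it conjugates the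
element and flips the sign when the element is that simple reflection. -/
noncomputable def signedConj (i : B) : Function.End (W × ZMod 2) :=
  fun p => (cs.simple i * p.1 * cs.simple i, p.2 + if p.1 = cs.simple i then 1 else 0)

theorem mul_simple_mul_pow (i j : B) (n : ℕ) :
    (cs.simple i * cs.simple j) ^ n * cs.simple j * (cs.simple i * cs.simple j) ^ n =
      cs.simple j := by
  induction n with
  | zero => simp
  | succ n ih =>
    set x := cs.simple i * cs.simple j with hx
    calc x ^ (n + 1) * cs.simple j * x ^ (n + 1)
      _ = x * x ^ n * cs.simple j * (x ^ n * x) := by rw [← pow_succ', ← pow_succ]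
      _ = x * (x ^ n * cs.simple j * x ^ n) * x := by simp only [mul_assoc]
      _ = cs.simple j := by rw [ih, hx]; simp [mul_assoc]

theorem conj_pow_eq_iff (i j : B) (n : ℕ) (t y : W) :
    (cs.simple i * cs.simple j) ^ n * t * ((cs.simple i * cs.simple j) ^ n)⁻¹ =
        cs.simple j * y * ((cs.simple i * cs.simple j) ^ n)⁻¹ ↔
      t = cs.simple j * (cs.simple i * cs.simple j) ^ n * y := by
  have h : ((cs.simple i * cs.simple j) ^ n)⁻¹ * cs.simple j =
      cs.simple j * (cs.simple i * cs.simple j) ^ n := by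
    rw [inv_mul_eq_iff_eq_mul, ← mul_assoc, cs.mul_simple_mul_pow]
  rw [mul_left_inj, ← eq_inv_mul_iff_mul_eq, ← mul_assoc, h]

open Classical in
theorem signedConj_mul_pow_apply (i j : B) (n : ℕ) (t : W) (ε : ZMod 2) :
    ((cs.signedConj i * cs.signedConj j) ^ n) (t, ε) =
      ((cs.simple i * cs.simple j) ^ n * t * ((cs.simple i * cs.simple j) ^ n)⁻¹,
        ε + ∑ l ∈ Finset.range (2 * n),
          if t = cs.simple j * (cs.simple i * cs.simple j) ^ l then 1 else 0) := by
  induction n with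
  | zero => simp; rfl
  | succ n ih =>
    have step : ((cs.signedConj i * cs.signedConj j) ^ (n + 1)) (t, ε) =
        cs.signedConj i (cs.signedConj j (((cs.signedConj i * cs.signedConj j) ^ n) (t, ε))) := by
      rw [pow_succ']; rfl
    rw [step, ih]
    set x := cs.simple i * cs.simple j with hx
    have h₁ : x ^ n * t * (x ^ n)⁻¹ = cs.simple j ↔ t = cs.simple j * x ^ (2 * n) := by
      have := cs.conj_pow_eq_iff i j n t (x ^ n)
      rw [← hx] at this
      rw [two_mul, pow_add, ← mul_assoc, ← this]
      simp
    have h₂ : cs.simple j * (x ^ n * t * (x ^ n)⁻¹) * cs.simple j = cs.simple i ↔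
        t = cs.simple j * x ^ (2 * n + 1) := by
      have := cs.conj_pow_eq_iff i j n t (x ^ (n + 1))
      rw [← hx] at this
      rw [two_mul, add_assoc, pow_add, ← mul_assoc (cs.simple j) (x ^ n), ← this, pow_succ' x n,
        ← mul_assoc _ x, mul_inv_cancel_right]
      generalize x ^ n * t * (x ^ n)⁻¹ = z
      rw [hx]
      constructor
      · intro h
        rw [← h]; simp [mul_assoc]
      · intro h
        rw [h]; simp [mul_assoc]
    simp only [signedConj]
    refine Prod.ext ?_ ?_
    · simp only [pow_succ' x n, mul_inv_rev, mul_assoc]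
      simp only [hx, mul_inv_rev, cs.inv_simple, mul_assoc]
    · simp only [h₁, h₂, mul_add, mul_one, Finset.sum_range_succ, add_assoc]

theorem isLiftable_signedConj : M.IsLiftable cs.signedConj := by
  classical
  intro i j
  funext ⟨t, ε⟩
  rw [cs.signedConj_mul_pow_apply, cs.simple_mul_simple_pow, two_mul, Finset.sum_range_add]
  simp only [pow_add, cs.simple_mul_simple_pow, one_mul, CharTwo.add_self_eq_zero]
  simp; rfl

theorem exists_lift_signedConj_wordProd_apply (ω : List B) (t : W) (ε : ZMod 2) :
    ∃ k : ℕ, (cs.lift ⟨_, cs.isLiftable_signedConj⟩ (cs.wordProd ω) (t, ε)) =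
      (cs.wordProd ω * t * (cs.wordProd ω)⁻¹, ε + k) ∧ (k ≠ 0 → t ∈ cs.rightInvSeq ω) := by
  induction ω with
  | nil => exact ⟨0, by simp; rfl, by simp⟩
  | cons i ω ih =>
    obtain ⟨k, hk, hmem⟩ := ih
    have step : cs.lift ⟨_, cs.isLiftable_signedConj⟩ (cs.wordProd (i :: ω)) (t, ε) =
        cs.signedConj i (cs.lift ⟨_, cs.isLiftable_signedConj⟩ (cs.wordProd ω) (t, ε)) := by
      rw [cs.wordProd_cons, map_mul, cs.lift_apply_simple]; rfl
    rw [step, hk]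
    by_cases h : cs.wordProd ω * t * (cs.wordProd ω)⁻¹ = cs.simple i
    · refine ⟨k + 1, ?_, fun _ => ?_⟩
      · simp only [signedConj, if_pos h, cs.wordProd_cons, mul_inv_rev, cs.inv_simple, mul_assoc,
          add_assoc, Nat.cast_add, Nat.cast_one]
      · rw [rightInvSeq, ← h]
        simp [mul_assoc]
    · refine ⟨k, ?_, fun hk0 => ?_⟩
      · simp only [signedConj, if_neg h, cs.wordProd_cons, mul_inv_rev, cs.inv_simple, mul_assoc,
          add_zero]
      · rw [rightInvSeq]
        exact List.mem_cons_of_mem _ (hmem hk0)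

/-- The exchange condition. -/
theorem exists_eraseIdx_of_isRightDescent {ω : List B} {i : B}
    (h : cs.IsRightDescent (cs.wordProd ω) i) :
    ∃ k < ω.length, cs.wordProd ω * cs.simple i = cs.wordProd (ω.eraseIdx k) := by
  suffices hmem : cs.simple i ∈ cs.rightInvSeq ω by
    obtain ⟨k, hk, hki⟩ := List.mem_iff_getElem.mp hmem
    refine ⟨k, by simpa using hk, ?_⟩
    rw [← cs.wordProd_mul_getD_rightInvSeq, List.getD_eq_getElem _ _ hk, hki]
  by_contra hmem
  obtain ⟨k, hk, hk0⟩ := cs.exists_lift_signedConj_wordProd_apply ω (cs.simple i) 1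
  obtain rfl : k = 0 := by
    by_contra h0
    exact hmem (hk0 h0)
  obtain ⟨ω', hω', hw'⟩ := cs.exists_isReduced (cs.wordProd ω * cs.simple i)
  obtain ⟨k', hk', hk0'⟩ := cs.exists_lift_signedConj_wordProd_apply ω' (cs.simple i) 0
  have step : cs.lift ⟨_, cs.isLiftable_signedConj⟩ (cs.wordProd ω * cs.simple i)
      (cs.simple i, 0) = cs.lift ⟨_, cs.isLiftable_signedConj⟩ (cs.wordProd ω)
        (cs.signedConj i (cs.simple i, 0)) := by
    rw [map_mul, cs.lift_apply_simple]; rfl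
  have hsi : cs.signedConj i (cs.simple i, 0) = (cs.simple i, 1) := by simp [signedConj]
  rw [← hw', step, hsi, hk] at hk'
  have hne : k' ≠ 0 := by
    rintro rfl
    simpa using congrArg Prod.snd hk'
  have := (cs.isRightInversion_of_mem_rightInvSeq hω' (hk0' hne)).2
  rw [← hw'] at this
  rw [IsRightDescent] at h
  simp at this
  omega

/-- The exchange condition for a product `u * v`: the letter is removed from `u` or from `v`. -/
theorem exchange_mul {u v : W} {i : B} (h : cs.IsRightDescent (u * v) i) :
    (∃ u', cs.length u' < cs.length u ∧ u * v * cs.simple i = u' * v) ∨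
      cs.IsRightDescent v i := by
  obtain ⟨α, hα, rfl⟩ := cs.exists_isReduced u
  obtain ⟨β, hβ, rfl⟩ := cs.exists_isReduced v
  rw [← cs.wordProd_append] at h
  obtain ⟨k, hk, he⟩ := cs.exists_eraseIdx_of_isRightDescent h
  rw [cs.wordProd_append] at he
  rcases lt_or_ge k α.length with hkα | hkα
  · left
    rw [List.eraseIdx_append_of_lt_length hkα, cs.wordProd_append] at he
    refine ⟨_, ?_, he⟩
    have := cs.length_wordProd_le (α.eraseIdx k)
    have := List.length_eraseIdx_add_one hkα
    rw [hα.eq]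
    omega
  · right
    rw [List.eraseIdx_append_of_length_le hkα, cs.wordProd_append, mul_assoc, mul_right_inj] at he
    rw [List.length_append] at hk
    have := cs.length_wordProd_le (β.eraseIdx (k - α.length))
    have := List.length_eraseIdx_add_one (l := β) (i := k - α.length) (by omega)
    rw [IsRightDescent, he, hβ.eq]
    omega

/-! ### Parabolic subgroups -/

/-- The standard parabolic subgroup generated by the simple reflections in `T`. -/
def parabolic (T : Finset B) : Subgroup W := Subgroup.closure (cs.simple '' T)

variable {cs} in
theorem simple_mem_parabolic {T : Finset B} {i : B} (hi : i ∈ T) :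
    cs.simple i ∈ cs.parabolic T :=
  Subgroup.subset_closure ⟨i, hi, rfl⟩

theorem parabolic_mono {T U : Finset B} (h : T ⊆ U) : cs.parabolic T ≤ cs.parabolic U :=
  Subgroup.closure_mono (Set.image_mono (by simpa using h))

theorem parabolic_univ [Fintype B] : cs.parabolic Finset.univ = ⊤ := by
  simp [parabolic, cs.subgroup_closure_range_simple]

theorem wordProd_mem_parabolic {T : Finset B} {ω : List B} (h : ∀ i ∈ ω, i ∈ T) :
    cs.wordProd ω ∈ cs.parabolic T := by
  induction ω with
  | nil => simp
  | cons i ω ih =>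
    rw [cs.wordProd_cons]
    exact mul_mem (simple_mem_parabolic (h i (by simp))) (ih fun j hj => h j (by simp [hj]))

/-- An element of a parabolic subgroup has a reduced word in the letters of that subgroup. -/
theorem exists_isReduced_of_mem_parabolic {T : Finset B} {w : W} (hw : w ∈ cs.parabolic T) :
    ∃ ω : List B, (∀ i ∈ ω, i ∈ T) ∧ cs.IsReduced ω ∧ cs.wordProd ω = w := by
  have step : ∀ w : W, ∀ i ∈ T,
      (∃ ω : List B, (∀ i ∈ ω, i ∈ T) ∧ cs.IsReduced ω ∧ cs.wordProd ω = w) →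
      ∃ ω : List B, (∀ i ∈ ω, i ∈ T) ∧ cs.IsReduced ω ∧ cs.wordProd ω = w * cs.simple i := by
    rintro _ i hi ⟨ω, hωT, hω, rfl⟩
    by_cases hd : cs.IsRightDescent (cs.wordProd ω) i
    · obtain ⟨k, hk, he⟩ := cs.exists_eraseIdx_of_isRightDescent hd
      refine ⟨ω.eraseIdx k, fun j hj => hωT j (List.mem_of_mem_eraseIdx hj), ?_, he.symm⟩
      rw [isRightDescent_iff, hω.eq, ← List.length_eraseIdx_add_one hk, he] at hd
      exact Nat.succ_injective hd
    · refine ⟨ω ++ [i], ?_, ?_, by simp [cs.wordProd_append]⟩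
      · intro j hj
        rcases List.mem_append.mp hj with hj | hj
        · exact hωT j hj
        · rwa [List.mem_singleton.mp hj]
      · rw [not_isRightDescent_iff, hω.eq] at hd
        simpa [IsReduced, cs.wordProd_append] using hd
  induction hw using Subgroup.closure_induction_right with
  | one => exact ⟨[], by simp, by simp [IsReduced], by simp⟩
  | mul_right x y hx hy ih =>
    obtain ⟨i, hi, rfl⟩ := hy
    exact step _ i hi ih
  | mul_inv_cancel x y hx hy ih =>
    obtain ⟨i, hi, rfl⟩ := hy
    rw [cs.inv_simple]
    exact step _ i hi ih

theorem parabolic_induction {T : Finset B} {p : W → Prop} (one : p 1)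
    (mul_simple : ∀ v ∈ cs.parabolic T, ∀ i ∈ T, ¬ cs.IsRightDescent v i → p v →
      p (v * cs.simple i)) {w : W} (hw : w ∈ cs.parabolic T) : p w := by
  obtain ⟨ω, hT, hω, rfl⟩ := cs.exists_isReduced_of_mem_parabolic hw
  clear hw
  induction ω using List.reverseRecOn with
  | nil => simpa using one
  | append_singleton ω i ih =>
    have hω' : cs.IsReduced ω := by simpa using hω.take ω.length
    have hT' : ∀ j ∈ ω, j ∈ T := fun j hj => hT j (by simp [hj])
    have hπ : cs.wordProd (ω ++ [i]) = cs.wordProd ω * cs.simple i := by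
      simp [cs.wordProd_append]
    rw [hπ]
    refine mul_simple _ (cs.wordProd_mem_parabolic hT') i (hT i (by simp)) ?_ (ih hT' hω')
    rw [not_isRightDescent_iff, ← hπ, hω.eq, hω'.eq]
    simp

theorem length_mul_of_forall_length_le {T : Finset B} {u : W}
    (hu : ∀ v ∈ cs.parabolic T, cs.length u ≤ cs.length (u * v)) {v : W}
    (hv : v ∈ cs.parabolic T) : cs.length (u * v) = cs.length u + cs.length v := by
  refine cs.parabolic_induction (T := T)
    (p := fun v => cs.length (u * v) = cs.length u + cs.length v) (by simp) ?_ hv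
  intro v hv i hi hd ih
  have hnd : ¬ cs.IsRightDescent (u * v) i := by
    intro h
    rcases cs.exchange_mul h with ⟨u', hlt, he⟩ | h
    · have := hu (v * cs.simple i * v⁻¹)
        (mul_mem (mul_mem hv (simple_mem_parabolic hi)) (inv_mem hv))
      rw [← mul_assoc, ← mul_assoc, he, mul_inv_cancel_right] at this
      omega
    · exact hd h
  rw [not_isRightDescent_iff] at hd hnd
  rw [← mul_assoc, hnd, hd, ih, add_assoc]

theorem exists_eq_mul_forall_length_le (T : Finset B) (w : W) :
    ∃ u, ∃ v ∈ cs.parabolic T, w = u * v ∧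
      ∀ x ∈ cs.parabolic T, cs.length u ≤ cs.length (u * x) := by
  obtain ⟨u, hu, hmin⟩ := (measure cs.length).wf.has_min {u | u⁻¹ * w ∈ cs.parabolic T}
    ⟨w, by simp⟩
  refine ⟨u, u⁻¹ * w, hu, by simp, fun x hx => ?_⟩
  by_contra! hlt
  exact hmin (u * x) (by simpa [mul_assoc] using mul_mem (inv_mem hx) hu) hlt

/-- Lengths add when an element without right descents in `T` is multiplied by an element of
the parabolic subgroup of `T`. -/
theorem length_mul_of_forall_not_isRightDescent {T : Finset B} {u v : W}
    (hu : ∀ i ∈ T, ¬ cs.IsRightDescent u i) (hv : v ∈ cs.parabolic T) :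
    cs.length (u * v) = cs.length u + cs.length v := by
  obtain ⟨u, y, hy, rfl, hmin⟩ := cs.exists_eq_mul_forall_length_le T u
  suffices y = 1 by
    subst this
    exact cs.length_mul_of_forall_length_le (by simpa using hmin) hv
  by_contra hne
  obtain ⟨ω, hT, hω, hy'⟩ := cs.exists_isReduced_of_mem_parabolic hy
  obtain rfl | ⟨ω, i, rfl⟩ := ω.eq_nil_or_concat'
  · exact hne (by simpa using hy'.symm)
  · have hi : i ∈ T := hT i (by simp)
    have hys : y * cs.simple i = cs.wordProd ω := by simp [← hy', cs.wordProd_append, mul_assoc]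
    refine hu i hi ?_
    rw [IsRightDescent, mul_assoc, cs.length_mul_of_forall_length_le hmin hy,
      cs.length_mul_of_forall_length_le hmin (mul_mem hy (simple_mem_parabolic hi)), hys, ← hy',
      hω.eq]
    have := cs.length_wordProd_le ω
    simp
    omega

theorem length_mul_inv_of_forall_isRightDescent {U : Finset B} {w v : W}
    (hw : ∀ i ∈ U, cs.IsRightDescent w i) (hv : v ∈ cs.parabolic U) :
    cs.length (w * v⁻¹) + cs.length v = cs.length w := by
  refine cs.parabolic_induction (T := U)
    (p := fun v => cs.length (w * v⁻¹) + cs.length v = cs.length w) (by simp) ?_ hv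
  intro v hv i hi hd ih
  have hdw : cs.IsRightDescent (w * v⁻¹ * v) i := by simpa using hw i hi
  obtain ⟨u', hlt, he⟩ := (cs.exchange_mul hdw).resolve_right hd
  have hu' : w * (v * cs.simple i)⁻¹ = u' := by
    rw [← mul_inv_eq_iff_eq_mul] at he
    simpa [mul_assoc] using he
  have := cs.length_mul_le u' (v * cs.simple i)
  rw [← hu', inv_mul_cancel_right, hu'] at this
  rw [not_isRightDescent_iff] at hd
  rw [hu']
  omega

theorem finite_length_eq [Finite B] (n : ℕ) : {w | cs.length w = n}.Finite := by
  refine ((List.finite_length_eq B n).image cs.wordProd).subset ?_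
  intro w hw
  obtain ⟨ω, hω, rfl⟩ := cs.exists_isReduced w
  exact ⟨ω, hω.eq.symm.trans hw, rfl⟩

theorem finite_parabolic_of_forall_isRightDescent [Finite B] {U : Finset B} {w : W}
    (hw : ∀ i ∈ U, cs.IsRightDescent w i) : (cs.parabolic U : Set W).Finite := by
  refine ((Set.finite_Iic (cs.length w)).biUnion fun n _ => cs.finite_length_eq n).subset ?_
  intro v hv
  have := cs.length_mul_inv_of_forall_isRightDescent hw hv
  simp only [Set.mem_iUnion, Set.mem_ofPred_eq]
  exact ⟨cs.length v, by simp only [Set.mem_Iic]; omega, rfl⟩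

end CoxeterSystem

namespace PowerSeries

open Polynomial in
/-- The rational power series over `R`: quotients of polynomials whose denominator has constant
coefficient one. -/
def rationalSubring (R : Type*) [CommRing R] : Subring R⟦X⟧ where
  carrier := {F | ∃ f g : R[X], g.coeff 0 = 1 ∧ (g : R⟦X⟧) * F = f}
  mul_mem' := by
    rintro F G ⟨f, g, hg, h⟩ ⟨f', g', hg', h'⟩
    refine ⟨f * f', g * g', by simp [mul_coeff_zero, hg, hg'], ?_⟩
    rw [Polynomial.coe_mul, Polynomial.coe_mul, ← h, ← h']
    ring
  one_mem' := ⟨1, 1, by simp, by simp⟩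
  add_mem' := by
    rintro F G ⟨f, g, hg, h⟩ ⟨f', g', hg', h'⟩
    refine ⟨f * g' + f' * g, g * g', by simp [mul_coeff_zero, hg, hg'], ?_⟩
    simp only [Polynomial.coe_add, Polynomial.coe_mul]
    rw [ ← h, ← h']
    ring
  zero_mem' := ⟨0, 1, by simp, by simp⟩
  neg_mem' := by
    rintro F ⟨f, g, hg, h⟩
    exact ⟨-f, g, hg, by rw [mul_neg, h, ← coeToPowerSeries.ringHom_apply,
      ← coeToPowerSeries.ringHom_apply, map_neg]⟩

theorem coe_mem_rationalSubring {R : Type*} [CommRing R] (f : Polynomial R) :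
    (f : PowerSeries R) ∈ rationalSubring R :=
  ⟨f, 1, by simp, by simp⟩

theorem mem_rationalSubring_of_mul_eq_one {R : Type*} [CommRing R] {F G : PowerSeries R}
    (hF : F ∈ rationalSubring R) (hF₁ : constantCoeff F = 1) (h : F * G = 1) :
    G ∈ rationalSubring R := by
  obtain ⟨f, g, hg, hfg⟩ := hF
  refine ⟨g, f, ?_, ?_⟩
  · rw [← Polynomial.constantCoeff_coe, ← hfg, map_mul, hF₁, Polynomial.constantCoeff_coe, hg,
      mul_one]
  · rw [← hfg, mul_assoc, h, mul_one]

end PowerSeries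

namespace CoxeterSystem

variable {B W : Type*} [Group W] {M : CoxeterMatrix B} (cs : CoxeterSystem M W)

/-! ### Length generating series -/

/-- The generating series of the length function on a set of group elements. -/
noncomputable def lengthSeries (A : Set W) : PowerSeries ℤ :=
  PowerSeries.mk fun n => ({w | w ∈ A ∧ cs.length w = n}.ncard : ℤ)

theorem coeff_lengthSeries (A : Set W) (n : ℕ) :
    PowerSeries.coeff n (cs.lengthSeries A) = ({w | w ∈ A ∧ cs.length w = n}.ncard : ℤ) :=
  PowerSeries.coeff_mk _ _

open Classical in
theorem coeff_lengthSeries_eq_sum [Finite B] (A : Set W) (n : ℕ) :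
    PowerSeries.coeff n (cs.lengthSeries A) =
      ∑ w ∈ (cs.finite_length_eq n).toFinset, if w ∈ A then 1 else 0 := by
  rw [coeff_lengthSeries, Finset.sum_boole, ← Set.ncard_coe_finset]
  congr 2
  ext w
  simp [and_comm]

theorem lengthSeries_empty : cs.lengthSeries ∅ = 0 := by
  ext n
  simp [coeff_lengthSeries]

theorem constantCoeff_lengthSeries_parabolic (T : Finset B) :
    PowerSeries.constantCoeff (cs.lengthSeries (cs.parabolic T : Set W)) = 1 := by
  have h : {w | w ∈ (cs.parabolic T : Set W) ∧ cs.length w = 0} = {1} := by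
    ext w
    simp only [cs.length_eq_zero_iff, Set.mem_ofPred_eq, Set.mem_singleton_iff]
    exact ⟨And.right, by rintro rfl; simp [one_mem]⟩
  rw [← PowerSeries.coeff_zero_eq_constantCoeff_apply, coeff_lengthSeries, h]
  simp

theorem lengthSeries_mem_rationalSubring_of_finite {A : Set W} (hA : A.Finite) :
    cs.lengthSeries A ∈ PowerSeries.rationalSubring ℤ := by
  obtain ⟨N, hN⟩ := (hA.image cs.length).bddAbove
  have h : cs.lengthSeries A = (PowerSeries.trunc (N + 1) (cs.lengthSeries A) : PowerSeries ℤ) := by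
    ext n
    rw [Polynomial.coeff_coe, PowerSeries.coeff_trunc]
    split_ifs with hn
    · rfl
    · rw [coeff_lengthSeries]
      have : {w | w ∈ A ∧ cs.length w = n} = ∅ := by
        ext w
        simp only [Set.mem_ofPred_eq, Set.mem_empty_iff_false, iff_false]
        rintro ⟨hw, rfl⟩
        have := hN ⟨w, hw, rfl⟩
        omega
      simp [this]
  rw [h]
  exact PowerSeries.coe_mem_rationalSubring _

/-- If multiplication is a length-additive bijection from `A × C` to `D`, the generating series
multiply. -/
theorem lengthSeries_mul [Finite B] {A C D : Set W}
    (hbij : Set.BijOn (fun p : W × W => p.1 * p.2) (A ×ˢ C) D)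
    (hlen : ∀ a ∈ A, ∀ c ∈ C, cs.length (a * c) = cs.length a + cs.length c) :
    cs.lengthSeries A * cs.lengthSeries C = cs.lengthSeries D := by
  classical
  have hfin : ∀ (E : Set W) n, {w | w ∈ E ∧ cs.length w = n}.Finite := fun E n =>
    (cs.finite_length_eq n).subset fun w hw => hw.2
  ext n
  simp only [PowerSeries.coeff_mul, coeff_lengthSeries, Set.ncard_eq_toFinset_card _ (hfin _ _)]
  norm_cast
  simp only [← Finset.card_product]
  rw [← Finset.card_sigma]
  refine Finset.card_bij (fun x _ => x.2.1 * x.2.2) ?_ ?_ ?_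
  · rintro ⟨⟨p, q⟩, a, c⟩ hx
    simp only [Finset.mem_sigma, Finset.HasAntidiagonal.mem_antidiagonal, Finset.mem_product,
      Set.Finite.mem_toFinset, Set.mem_ofPred_eq] at hx ⊢
    obtain ⟨rfl, ⟨ha, rfl⟩, hc, rfl⟩ := hx
    exact ⟨hbij.mapsTo (x := (a, c)) ⟨ha, hc⟩, hlen a ha c hc⟩
  · rintro ⟨⟨p, q⟩, a, c⟩ hx ⟨⟨p', q'⟩, a', c'⟩ hx' he
    simp only [Finset.mem_sigma, Finset.HasAntidiagonal.mem_antidiagonal, Finset.mem_product,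
      Set.Finite.mem_toFinset, Set.mem_ofPred_eq] at hx hx'
    obtain ⟨-, ⟨ha, rfl⟩, hc, rfl⟩ := hx
    obtain ⟨-, ⟨ha', rfl⟩, hc', rfl⟩ := hx'
    have := hbij.injOn (x₁ := (a, c)) (x₂ := (a', c')) ⟨ha, hc⟩ ⟨ha', hc'⟩ he
    obtain ⟨rfl, rfl⟩ := Prod.mk.inj this
    rfl
  · intro d hd
    simp only [Set.Finite.mem_toFinset, Set.mem_ofPred_eq] at hd
    obtain ⟨hd, rfl⟩ := hd
    obtain ⟨⟨a, c⟩, ⟨ha, hc⟩, rfl⟩ := hbij.surjOn hd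
    refine ⟨⟨(cs.length a, cs.length c), a, c⟩, ?_, rfl⟩
    simp only [Finset.mem_sigma, Finset.HasAntidiagonal.mem_antidiagonal, Finset.mem_product,
      Set.Finite.mem_toFinset, Set.mem_ofPred_eq, and_true]
    exact ⟨(hlen a ha c hc).symm, ha, hc⟩

/-- The minimal length representatives of the left cosets of `cs.parabolic T` in
`cs.parabolic U`. -/
def minCosetReps (U T : Finset B) : Set W :=
  {w | w ∈ cs.parabolic U ∧ ∀ i ∈ T, ¬ cs.IsRightDescent w i}

theorem bijOn_minCosetReps_mul {U T : Finset B} (h : T ⊆ U) :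
    Set.BijOn (fun p : W × W => p.1 * p.2) (cs.minCosetReps U T ×ˢ (cs.parabolic T : Set W))
      (cs.parabolic U) := by
  refine ⟨?_, ?_, ?_⟩
  · rintro ⟨u, v⟩ ⟨hu, hv⟩
    exact mul_mem hu.1 (cs.parabolic_mono h hv)
  · rintro ⟨u, v⟩ ⟨hu, hv⟩ ⟨u', v'⟩ ⟨hu', hv'⟩ he
    simp only [SetLike.mem_coe] at hu hv hu' hv' he
    have hx : v * v'⁻¹ ∈ cs.parabolic T := mul_mem hv (inv_mem hv')
    have hux : u * (v * v'⁻¹) = u' := by rw [← mul_assoc, he, mul_inv_cancel_right]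
    have h₁ := cs.length_mul_of_forall_not_isRightDescent hu.2 hx
    have h₂ := cs.length_mul_of_forall_not_isRightDescent hu'.2 (inv_mem hx)
    rw [← hux, mul_inv_cancel_right, hux] at h₂
    rw [hux] at h₁
    have h₃ : v * v'⁻¹ = 1 := cs.length_eq_zero_iff.mp (by omega)
    rw [h₃, mul_one] at hux
    rw [mul_inv_eq_one] at h₃
    rw [hux, h₃]
  · intro w hw
    obtain ⟨u, v, hv, rfl, hmin⟩ := cs.exists_eq_mul_forall_length_le T w
    refine ⟨(u, v), ⟨⟨?_, fun i hi hd => ?_⟩, hv⟩, rfl⟩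
    · simpa using mul_mem hw (inv_mem (cs.parabolic_mono h hv))
    · exact (hmin _ (simple_mem_parabolic hi)).not_gt hd

theorem lengthSeries_minCosetReps_mul [Finite B] {U T : Finset B} (h : T ⊆ U) :
    cs.lengthSeries (cs.minCosetReps U T) * cs.lengthSeries (cs.parabolic T : Set W) =
      cs.lengthSeries (cs.parabolic U : Set W) :=
  cs.lengthSeries_mul (cs.bijOn_minCosetReps_mul h) fun _ hu _ hv =>
    cs.length_mul_of_forall_not_isRightDescent hu.2 hv

theorem sum_neg_one_pow_card_mul_lengthSeries_minCosetReps [Finite B] (U : Finset B) :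
    ∑ T ∈ U.powerset, (-1) ^ T.card * cs.lengthSeries (cs.minCosetReps U T) =
      cs.lengthSeries {w | w ∈ cs.parabolic U ∧ ∀ i ∈ U, cs.IsRightDescent w i} := by
  classical
  have hC : ∀ k : ℕ, (-1 : PowerSeries ℤ) ^ k = PowerSeries.C ((-1 : ℤ) ^ k) := by simp
  ext n
  simp only [map_sum, hC, PowerSeries.coeff_C_mul, coeff_lengthSeries_eq_sum, Finset.mul_sum]
  rw [Finset.sum_comm]
  refine Finset.sum_congr rfl fun w _ => ?_
  by_cases hw : w ∈ cs.parabolic U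
  · have hfilter : U.powerset.filter (fun T => w ∈ cs.minCosetReps U T) =
        (U.filter fun i => ¬ cs.IsRightDescent w i).powerset := by
      ext T
      simp only [minCosetReps, Finset.mem_filter, Finset.mem_powerset, Set.mem_ofPred_eq, hw,
        true_and, Finset.subset_iff]
      grind
    simp only [mul_ite, mul_one, mul_zero]
    rw [← Finset.sum_filter, hfilter, Finset.sum_powerset_neg_one_pow_card]
    simp [hw, Finset.filter_eq_empty_iff]
  · simp [minCosetReps, hw]

theorem lengthSeries_parabolic_mem_rationalSubring [Finite B] (U : Finset B) :
    cs.lengthSeries (cs.parabolic U : Set W) ∈ PowerSeries.rationalSubring ℤ := by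
  classical
  induction U using Finset.strongInduction with
  | H U ih =>
  by_cases hfin : (cs.parabolic U : Set W).Finite
  · exact cs.lengthSeries_mem_rationalSubring_of_finite hfin
  have hinv : ∀ T : Finset B, ∃ Q, cs.lengthSeries (cs.parabolic T : Set W) * Q = 1 := fun T =>
    ⟨_, PowerSeries.mul_invOfUnit _ 1 (by simp [cs.constantCoeff_lengthSeries_parabolic])⟩
  choose Q hQ using hinv
  set P := cs.lengthSeries (cs.parabolic U : Set W) with hP
  have hsum := cs.sum_neg_one_pow_card_mul_lengthSeries_minCosetReps U
  have hempty : {w | w ∈ cs.parabolic U ∧ ∀ i ∈ U, cs.IsRightDescent w i} = ∅ :=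
    Set.eq_empty_of_forall_notMem fun w hw =>
      hfin (cs.finite_parabolic_of_forall_isRightDescent hw.2)
  have hreps : ∀ T ∈ U.powerset, (-1) ^ T.card * cs.lengthSeries (cs.minCosetReps U T) =
      P * ((-1) ^ T.card * Q T) := by
    intro T hT
    rw [hP, ← cs.lengthSeries_minCosetReps_mul (Finset.mem_powerset.mp hT)]
    linear_combination (-(-1) ^ T.card * cs.lengthSeries (cs.minCosetReps U T)) * hQ T
  rw [hempty, lengthSeries_empty, Finset.sum_congr rfl hreps, ← Finset.mul_sum,
    ← Finset.insert_erase (Finset.mem_powerset_self U), Finset.sum_insert (by simp),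
    ← Finset.ssubsets, mul_add, mul_left_comm, hQ U, mul_one] at hsum
  set Y := ∑ T ∈ U.ssubsets, (-1) ^ T.card * Q T with hY
  have hYmem : Y ∈ PowerSeries.rationalSubring ℤ := by
    refine sum_mem fun T hT => mul_mem (pow_mem (neg_mem (one_mem _)) _) ?_
    exact PowerSeries.mem_rationalSubring_of_mul_eq_one (ih T (Finset.mem_ssubsets.mp hT))
      (cs.constantCoeff_lengthSeries_parabolic T) (hQ T)
  have hsq : ((-1 : PowerSeries ℤ) ^ U.card) * (-1) ^ U.card = 1 := by
    rw [← mul_pow]; simp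
  have hPY : (-(-1) ^ U.card * Y) * P = 1 := by
    linear_combination -(-1) ^ U.card * hsum + hsq
  refine PowerSeries.mem_rationalSubring_of_mul_eq_one
    (mul_mem (neg_mem (pow_mem (neg_mem (one_mem _)) _)) hYmem) ?_ hPY
  have := congrArg PowerSeries.constantCoeff hPY
  rwa [map_mul, hP, cs.constantCoeff_lengthSeries_parabolic, mul_one, map_one] at this

end CoxeterSystem


/-- **Rationality of the growth series.**
Let `(W, S)` be a Coxeter system with `S` finite, and let
`W(t) = Σ_{w ∈ W} t^{ℓ w} = Σ_n a_n tⁿ ∈ ℤ⟦t⟧` (where `a_n = #{w : ℓ w = n}`) be its growth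
series.  Then `W(t)` is a rational power series: there exist polynomials `f, g ∈ ℤ[t]` with
`g(0) = 1` such that `g · W(t) = f` in `ℤ⟦t⟧`. -/
theorem growth_series_rational {B : Type*} [Fintype B] {W : Type*} [Group W]
    {M : CoxeterMatrix B} (cs : CoxeterSystem M W) :
    ∃ f g : Polynomial ℤ, g.coeff 0 = 1 ∧
      (g : PowerSeries ℤ) *
          PowerSeries.mk (fun n => (Nat.card {w : W // cs.length w = n} : ℤ)) =
        (f : PowerSeries ℤ) := by
  have h := cs.lengthSeries_parabolic_mem_rationalSubring Finset.univ
  rw [cs.parabolic_univ] at h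
  obtain ⟨f, g, hg, hfg⟩ := h
  refine ⟨f, g, hg, ?_⟩
  simp only [CoxeterSystem.lengthSeries, Subgroup.coe_top, Set.mem_univ, true_and,
    ← Nat.card_coe_set_eq] at hfg
  exact hfg
end

section
/- Let (W,S) be a Coxeter system with S finite. Then W contains no subgroup isomorphic to the free group on two generators if and only if W is virtually abelian (i.e., W has an abelian subgroup of finite index). -/
/-- The orthogonal reflection in a vector `x` with `Q x x = 1`. -/
noncomputable def LinearMap.BilinForm.unitReflection {V : Type*} [AddCommGroup V] [Module ℝ V]
    (Q : LinearMap.BilinForm ℝ V) (x : V) : V →ₗ[ℝ] V :=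
  LinearMap.id - ((2 : ℝ) • Q.flip x).smulRight x

namespace CoxeterTits

section Reflection

variable {V : Type*} [AddCommGroup V] [Module ℝ V] {Q : LinearMap.BilinForm ℝ V}

theorem unitReflection_apply (x v : V) : Q.unitReflection x v = v - (2 * Q v x) • x := by
  simp [LinearMap.BilinForm.unitReflection]

theorem unitReflection_self {x : V} (hx : Q x x = 1) : Q.unitReflection x x = -x := by
  rw [unitReflection_apply, hx]; module

theorem unitReflection_unitReflection {x : V} (hx : Q x x = 1) (v : V) :
    Q.unitReflection x (Q.unitReflection x v) = v := by
  simp only [unitReflection_apply, map_sub, map_smul, hx]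
  module

theorem unitReflection_mul_self {x : V} (hx : Q x x = 1) :
    Q.unitReflection x * Q.unitReflection x = 1 :=
  LinearMap.ext fun v => unitReflection_unitReflection hx v

theorem isometry_unitReflection (hQ : Q.IsSymm) {x : V} (hx : Q x x = 1) (v w : V) :
    Q (Q.unitReflection x v) (Q.unitReflection x w) = Q v w := by
  simp only [unitReflection_apply, map_sub, map_smul, LinearMap.sub_apply, LinearMap.smul_apply,
    smul_eq_mul, hx, hQ.eq x w]
  ring

theorem pow_rotation_left {x y : V} {θ : ℝ} (hQ : Q.IsSymm) (hx : Q x x = 1) (hy : Q y y = 1)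
    (hxy : Q x y = -Real.cos θ) (k : ℕ) :
    Real.sin θ • ((Q.unitReflection x * Q.unitReflection y) ^ k) x =
      Real.sin ((2 * k + 1) * θ) • x + Real.sin (2 * k * θ) • y := by
  have hyx : Q y x = -Real.cos θ := by rw [← hxy]; exact hQ.eq y x
  induction k with
  | zero => simp
  | succ k ih =>
    rw [pow_succ', Module.End.mul_apply, ← map_smul, ih]
    simp only [Module.End.mul_apply, map_add, map_smul, unitReflection_apply, map_sub,
      hx, hy, hxy, hyx]
    have e1 : Real.sin ((2 * (k + 1 : ℕ) + 1) * θ) = Real.sin ((2 * k + 1) * θ) *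
      (2 * (2 * Real.cos θ ^ 2 - 1)) - Real.sin (2 * k * θ - θ) := by
      have : (2 * ((k + 1 : ℕ) : ℝ) + 1) * θ = (2 * k + 1) * θ + 2 * θ := by push_cast; ring
      rw [this, Real.sin_add, ← Real.cos_two_mul,
        show 2 * k * θ - θ = (2 * k + 1) * θ - 2 * θ by ring, Real.sin_sub]
      ring
    have e2 : Real.sin (2 * (k + 1 : ℕ) * θ) = 2 * Real.cos θ * Real.sin ((2 * k + 1) * θ) -
      Real.sin (2 * k * θ) := by
      have : 2 * ((k + 1 : ℕ) : ℝ) * θ = (2 * k + 1) * θ + θ := by push_cast; ring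
      rw [this, Real.sin_add, show 2 * k * θ = (2 * k + 1) * θ - θ by ring, Real.sin_sub]
      ring
    have e3 : Real.sin (2 * k * θ - θ) =
        2 * Real.cos θ * Real.sin (2 * k * θ) - Real.sin ((2 * k + 1) * θ) := by
      rw [show (2 * k + 1) * θ = 2 * k * θ + θ by ring, Real.sin_add, Real.sin_sub]; ring
    rw [e1, e2, e3]
    module

theorem pow_rotation_right {x y : V} {θ : ℝ} (hQ : Q.IsSymm) (hx : Q x x = 1) (hy : Q y y = 1)
    (hxy : Q x y = -Real.cos θ) (k : ℕ) :
    Real.sin θ • ((Q.unitReflection x * Q.unitReflection y) ^ k) y =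
      -(Real.sin (2 * k * θ) • x + Real.sin (2 * k * θ - θ) • y) := by
  have hyx : Q y x = -Real.cos θ := by rw [← hxy]; exact hQ.eq y x
  induction k with
  | zero => simp
  | succ k ih =>
    rw [pow_succ', Module.End.mul_apply, ← map_smul, ih]
    simp only [Module.End.mul_apply, map_add, map_neg, map_smul, unitReflection_apply, map_sub,
      hx, hy, hxy, hyx]
    have e1 : Real.sin (2 * (k + 1 : ℕ) * θ) = Real.sin (2 * k * θ) *
      (2 * (2 * Real.cos θ ^ 2 - 1)) - Real.sin (2 * k * θ - θ - θ) := by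
      have : (2 * ((k + 1 : ℕ) : ℝ)) * θ = (2 * k) * θ + 2 * θ := by push_cast; ring
      rw [this, Real.sin_add, ← Real.cos_two_mul,
        show 2 * k * θ - θ - θ = (2 * k) * θ - 2 * θ by ring, Real.sin_sub]
      ring
    have e2 : Real.sin (2 * (k + 1 : ℕ) * θ - θ) = 2 * Real.cos θ * Real.sin (2 * k * θ) -
      Real.sin (2 * k * θ - θ) := by
      have : 2 * ((k + 1 : ℕ) : ℝ) * θ - θ = (2 * k) * θ + θ := by push_cast; ring
      rw [this, Real.sin_add, Real.sin_sub]
      ring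
    have e3 : Real.sin (2 * k * θ - θ - θ) =
        2 * Real.cos θ * Real.sin (2 * k * θ - θ) - Real.sin (2 * k * θ) := by
      rw [show Real.sin (2 * k * θ) = Real.sin (2 * k * θ - θ + θ) by ring_nf, Real.sin_add,
        Real.sin_sub (2 * k * θ - θ)]
      ring
    rw [e1, e2, e3]
    module

/-- The product of two reflections whose roots meet at the angle `π - π / m` has order
dividing `m`. -/
theorem unitReflection_mul_pow_eq_one {x y : V} {m : ℕ} (hm : 2 ≤ m) (hQ : Q.IsSymm)
    (hx : Q x x = 1) (hy : Q y y = 1) (hxy : Q x y = -Real.cos (Real.pi / m)) :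
    (Q.unitReflection x * Q.unitReflection y) ^ m = 1 := by
  have hyx : Q y x = -Real.cos (Real.pi / m) := by rw [← hxy]; exact hQ.eq y x
  set θ := Real.pi / m with hθ
  have hm' : (2 : ℝ) ≤ m := by exact_mod_cast hm
  have hθm : (m : ℝ) * θ = Real.pi := by rw [hθ]; field_simp
  have hs : 0 < Real.sin θ := by
    apply Real.sin_pos_of_pos_of_lt_pi
    · positivity
    · rw [hθ, div_lt_iff₀ (by linarith)]; nlinarith [Real.pi_pos]
  set g := Q.unitReflection x * Q.unitReflection y with hg
  have gx : (g ^ m) x = x := by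
    have h := pow_rotation_left hQ hx hy hxy m
    rw [show (2 * (m : ℝ) + 1) * θ = θ + 2 * Real.pi by linear_combination 2 * hθm,
      show 2 * (m : ℝ) * θ = 2 * Real.pi by linear_combination 2 * hθm, Real.sin_add_two_pi,
      Real.sin_two_pi, zero_smul, add_zero] at h
    exact smul_right_injective V hs.ne' h
  have gy : (g ^ m) y = y := by
    have h := pow_rotation_right hQ hx hy hxy m
    rw [show 2 * (m : ℝ) * θ = 2 * Real.pi by linear_combination 2 * hθm,
      Real.sin_two_pi, zero_smul, zero_add, Real.sin_two_pi_sub, neg_smul, neg_neg] at h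
    exact smul_right_injective V hs.ne' h
  have fix : ∀ v, Q v x = 0 → Q v y = 0 → (g ^ m) v = v := by
    intro v h1 h2
    have : g v = v := by
      simp [hg, unitReflection_apply, h1, h2]
    have hk : ∀ k : ℕ, (g ^ k) v = v := by
      intro k
      induction k with
      | zero => simp
      | succ k ih => rw [pow_succ', Module.End.mul_apply, ih, this]
    exact hk m
  ext v
  set c := Real.cos θ
  have hcs : 1 - c ^ 2 ≠ 0 := by
    have := Real.sin_sq_add_cos_sq θ
    have : 1 - c ^ 2 = Real.sin θ ^ 2 := by simp only [c]; linarith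
    rw [this]; positivity
  set p := (Q v x + c * Q v y) / (1 - c ^ 2)
  set q := (Q v y + c * Q v x) / (1 - c ^ 2)
  have hv : v = (v - p • x - q • y) + p • x + q • y := by abel
  have h0 := fix (v - p • x - q • y)
    (by simp [hx, hyx, p, q]; field_simp; ring) (by simp [hy, hxy, p, q]; field_simp; ring)
  rw [Module.End.one_apply]
  nth_rewrite 1 [hv]
  rw [map_add, map_add, h0, map_smul, map_smul, gx, gy, ← hv]

end Reflection

section GeometricRepresentation

variable {B : Type*} [Fintype B] [DecidableEq B]

/-- The canonical bilinear form `⟨eᵢ, eⱼ⟩ = -cos (π / mᵢⱼ)`; the convention `π / 0 = 0` gives the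
value `-1` for `mᵢⱼ = ∞`. -/
noncomputable def canonicalForm (M : CoxeterMatrix B) : LinearMap.BilinForm ℝ (B → ℝ) :=
  Matrix.toBilin' (Matrix.of fun i j => -Real.cos (Real.pi / M i j))

/-- The simple root attached to an index. -/
def simpleRoot (i : B) : B → ℝ := Pi.single i 1

theorem canonicalForm_simpleRoot (M : CoxeterMatrix B) (i j : B) :
    canonicalForm M (simpleRoot i) (simpleRoot j) = -Real.cos (Real.pi / M i j) := by
  simp [canonicalForm, simpleRoot]

theorem canonicalForm_simpleRoot_self (M : CoxeterMatrix B) (i : B) :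
    canonicalForm M (simpleRoot i) (simpleRoot i) = 1 := by
  simp [canonicalForm_simpleRoot]

theorem canonicalForm_isSymm (M : CoxeterMatrix B) : (canonicalForm M).IsSymm := by
  rw [canonicalForm, Matrix.isSymm_toBilin'_iff_isSymm]
  ext i j
  simp [M.symmetric i j]

theorem canonicalForm_comm (M : CoxeterMatrix B) (v w : B → ℝ) :
    canonicalForm M v w = canonicalForm M w v :=
  (canonicalForm_isSymm M).eq v w

theorem eq_sum_simpleRoot (v : B → ℝ) : v = ∑ i, v i • simpleRoot i := by
  ext j
  simp [simpleRoot, Finset.sum_apply, Pi.single_apply]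

variable {M : CoxeterMatrix B} {W : Type*} [Group W] (cs : CoxeterSystem M W)

theorem isLiftable_unitReflection : M.IsLiftable
    fun i => (canonicalForm M).unitReflection (simpleRoot i) := by
  intro i j
  rcases eq_or_ne i j with rfl | hij
  · simpa using unitReflection_mul_self (canonicalForm_simpleRoot_self M i)
  rcases Nat.eq_zero_or_pos (M i j) with h | h
  · simp [h]
  · have := M.off_diagonal i j hij
    exact unitReflection_mul_pow_eq_one (by lia) (canonicalForm_isSymm M)
      (canonicalForm_simpleRoot_self M i) (canonicalForm_simpleRoot_self M j)
      (canonicalForm_simpleRoot M i j)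

/-- The geometric representation of a Coxeter group. -/
noncomputable def geometricRep : W →* Module.End ℝ (B → ℝ) :=
  cs.lift ⟨_, isLiftable_unitReflection⟩

theorem geometricRep_simple (i : B) :
    geometricRep cs (cs.simple i) = (canonicalForm M).unitReflection (simpleRoot i) :=
  cs.lift_apply_simple _ i

theorem geometricRep_inv_apply (w : W) (v : B → ℝ) :
    geometricRep cs w⁻¹ (geometricRep cs w v) = v := by
  rw [← Module.End.mul_apply, ← map_mul, inv_mul_cancel, map_one, Module.End.one_apply]

theorem geometricRep_isometry (w : W) (v v' : B → ℝ) :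
    canonicalForm M (geometricRep cs w v) (geometricRep cs w v') = canonicalForm M v v' := by
  induction w using cs.simple_induction_left generalizing v v' with
  | one => simp
  | mul_simple_left w i ih =>
    rw [map_mul, Module.End.mul_apply, Module.End.mul_apply, geometricRep_simple,
      isometry_unitReflection (canonicalForm_isSymm M) (canonicalForm_simpleRoot_self M i), ih]

theorem geometricRep_alternatingWord {i j : B} {p : ℕ → ℝ} (h0 : p 0 = 0) (h1 : p 1 = 1)
    (hp : ∀ k, p (k + 2) = 2 * Real.cos (Real.pi / M i j) * p (k + 1) - p k) (k : ℕ) :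
    geometricRep cs (cs.wordProd (CoxeterSystem.alternatingWord i j k)) (simpleRoot i) =
      if Even k then p (k + 1) • simpleRoot i + p k • simpleRoot j
      else p k • simpleRoot i + p (k + 1) • simpleRoot j := by
  have hji := canonicalForm_simpleRoot M j i
  rw [M.symmetric j i] at hji
  induction k with
  | zero => simp [CoxeterSystem.alternatingWord, h0, h1]
  | succ k ih =>
    rw [CoxeterSystem.alternatingWord_succ', cs.wordProd_cons, map_mul, Module.End.mul_apply, ih,
      geometricRep_simple, hp]
    by_cases hk : Even k
    · simp only [hk, if_true, Nat.even_add_one, not_true, if_false, map_add, map_smul,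
        unitReflection_apply, canonicalForm_simpleRoot M i j, canonicalForm_simpleRoot_self]
      module
    · simp only [hk, if_false, Nat.even_add_one, not_false_eq_true, if_true, map_add, map_smul,
        unitReflection_apply, hji, canonicalForm_simpleRoot_self]
      module

theorem exists_nonneg_geometricRep_alternatingWord {i j : B} (hij : i ≠ j) {k : ℕ}
    (hk : M i j = 0 ∨ k + 1 ≤ M i j) :
    ∃ p q : ℝ, 0 ≤ p ∧ 0 ≤ q ∧
      geometricRep cs (cs.wordProd (CoxeterSystem.alternatingWord i j k)) (simpleRoot i) =
        p • simpleRoot i + q • simpleRoot j := by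
  have key : ∃ p : ℕ → ℝ, p 0 = 0 ∧ p 1 = 1 ∧
      (∀ k, p (k + 2) = 2 * Real.cos (Real.pi / M i j) * p (k + 1) - p k) ∧
      0 ≤ p k ∧ 0 ≤ p (k + 1) := by
    rcases Nat.eq_zero_or_pos (M i j) with h | h
    · refine ⟨fun k => k, by simp, by simp, fun k => ?_, by positivity, by positivity⟩
      simp only [h, Nat.cast_zero, div_zero, Real.cos_zero]
      push_cast
      ring
    · have hne := M.off_diagonal i j hij
      have hk' : ((k : ℝ) + 1) ≤ M i j := by
        have : k + 1 ≤ M i j := by lia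
        exact_mod_cast this
      have hm : (2 : ℝ) ≤ M i j := by
        have : 2 ≤ M i j := by lia
        exact_mod_cast this
      set θ := Real.pi / M i j with hθ
      have hθm : (M i j : ℝ) * θ = Real.pi := by rw [hθ]; field_simp
      have hθ0 : 0 < θ := by positivity
      have hs : 0 < Real.sin θ := by
        apply Real.sin_pos_of_pos_of_lt_pi hθ0
        nlinarith [Real.pi_pos]
      have hnn : ∀ n : ℕ, (n : ℝ) ≤ M i j → 0 ≤ Real.sin (n * θ) / Real.sin θ := by
        intro n hn
        apply div_nonneg _ hs.le
        apply Real.sin_nonneg_of_nonneg_of_le_pi (by positivity)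
        rw [← hθm]
        gcongr
      refine ⟨fun k => Real.sin (k * θ) / Real.sin θ, by simp, by simp [hs.ne'], fun n => ?_,
        hnn k (by linarith), hnn (k + 1) (by push_cast; linarith)⟩
      have e1 : ((n + 2 : ℕ) : ℝ) * θ = ((n + 1 : ℕ) : ℝ) * θ + θ := by push_cast; ring
      have e2 : (n : ℝ) * θ = ((n + 1 : ℕ) : ℝ) * θ - θ := by push_cast; ring
      simp only [e1, e2, Real.sin_add, Real.sin_sub]
      field_simp
      ring
  obtain ⟨p, h0, h1, hp, hk0, hk1⟩ := key
  rw [geometricRep_alternatingWord cs h0 h1 hp]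
  split_ifs
  · exact ⟨_, _, hk1, hk0, rfl⟩
  · exact ⟨_, _, hk0, hk1, rfl⟩

/-- If `w sᵢ` is longer than `w`, then `w` maps the simple root `eᵢ` to a positive root. -/
theorem geometricRep_simpleRoot_nonneg (w : W) (i : B)
    (hw : cs.length w < cs.length (w * cs.simple i)) :
    0 ≤ geometricRep cs w (simpleRoot i) := by
  induction hn : cs.length w using Nat.strong_induction_on generalizing w i with
  | _ n ih =>
  subst hn
  rcases eq_or_ne w 1 with rfl | hw1
  · rw [map_one, Module.End.one_apply, simpleRoot, Pi.single_nonneg]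
    exact zero_le_one
  obtain ⟨j, hj⟩ := cs.exists_rightDescent_of_ne_one hw1
  have hij : i ≠ j := by
    rintro rfl
    exact absurd hw (not_lt.mpr hj.le)
  let P : ℕ → Prop := fun k => ∃ v : W,
    w = v * cs.wordProd (CoxeterSystem.alternatingWord i j k) ∧ cs.length w = cs.length v + k
  have hP1 : P 1 := by
    refine ⟨w * cs.simple j, by simp [CoxeterSystem.alternatingWord, mul_assoc], ?_⟩
    have := cs.isRightDescent_iff.mp hj
    lia
  obtain ⟨k, hk1, ⟨v, hwv, hlen⟩, hmax⟩ : ∃ k, 1 ≤ k ∧ P k ∧ ¬ P (k + 1) := by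
    by_contra! hcon
    have hall : ∀ k, P (k + 1) := by
      intro k
      induction k with
      | zero => exact hP1
      | succ k ih => exact hcon _ (by lia) ih
    obtain ⟨v, -, hv⟩ := hall (cs.length w)
    lia
  set u := cs.wordProd (CoxeterSystem.alternatingWord i j k) with hu
  have hlu : cs.length u ≤ k := by
    simpa using cs.length_wordProd_le (CoxeterSystem.alternatingWord i j k)
  obtain ⟨l, rfl⟩ : ∃ l, k = l + 1 := ⟨k - 1, by lia⟩
  -- `v` has neither `i` nor `j` as a right descent
  have hfirst : ∀ x, x = (if Even l then j else i) → cs.length v < cs.length (v * cs.simple x) := by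
    intro x hx
    by_contra hcon
    have hd : cs.IsRightDescent v x := lt_of_le_of_ne (not_lt.mp hcon) (cs.length_mul_simple_ne v x)
    have h1 := cs.isRightDescent_iff.mp hd
    have hw' : w = (v * cs.simple x) * cs.wordProd (CoxeterSystem.alternatingWord i j l) := by
      rw [hwv, hu, CoxeterSystem.alternatingWord_succ', ← hx, cs.wordProd_cons, mul_assoc]
    have h2 := cs.length_mul_le (v * cs.simple x)
      (cs.wordProd (CoxeterSystem.alternatingWord i j l))
    rw [← hw'] at h2
    have h3 := cs.length_wordProd_le (CoxeterSystem.alternatingWord i j l)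
    rw [CoxeterSystem.length_alternatingWord] at h3
    lia
  have hsecond : ∀ x, x = (if Even (l + 1) then j else i) →
      cs.length v < cs.length (v * cs.simple x) := by
    intro x hx
    by_contra hcon
    have hd : cs.IsRightDescent v x := lt_of_le_of_ne (not_lt.mp hcon) (cs.length_mul_simple_ne v x)
    have h1 := cs.isRightDescent_iff.mp hd
    refine hmax ⟨v * cs.simple x, ?_, by lia⟩
    rw [CoxeterSystem.alternatingWord_succ', ← hx, cs.wordProd_cons, mul_assoc,
      cs.simple_mul_simple_cancel_left, hwv]
  have hvi : cs.length v < cs.length (v * cs.simple i) := by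
    by_cases hl : Even l
    · exact hsecond i (by simp [hl, Nat.even_add_one])
    · exact hfirst i (by simp [hl])
  have hvj : cs.length v < cs.length (v * cs.simple j) := by
    by_cases hl : Even l
    · exact hfirst j (by simp [hl])
    · exact hsecond j (by simp [hl, Nat.even_add_one])
  have hbound : M i j = 0 ∨ (l + 1) + 1 ≤ M i j := by
    rcases Nat.eq_zero_or_pos (M i j) with h | h
    · exact Or.inl h
    · refine Or.inr (not_lt.mp fun hcon => ?_)
      rw [M.symmetric i j] at h hcon
      refine cs.not_isReduced_alternatingWord j i h.ne' hcon ?_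
      rw [CoxeterSystem.IsReduced, CoxeterSystem.length_alternatingWord]
      apply le_antisymm
      · simpa using cs.length_wordProd_le (CoxeterSystem.alternatingWord j i (l + 1 + 1))
      · rw [CoxeterSystem.alternatingWord_succ, cs.wordProd_concat, ← hu]
        have h1 := cs.length_mul_le v (u * cs.simple i)
        rw [← mul_assoc, ← hwv] at h1
        lia
  obtain ⟨p, q, hp, hq, hpq⟩ := exists_nonneg_geometricRep_alternatingWord cs hij hbound
  rw [hwv, map_mul, Module.End.mul_apply, hu, hpq, map_add, map_smul, map_smul]
  have hvw : cs.length v < cs.length w := by lia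
  exact add_nonneg (smul_nonneg hp (ih _ hvw v i hvi rfl)) (smul_nonneg hq (ih _ hvw v j hvj rfl))

/-- An element keeping the diagonal coordinates of all simple roots positive is trivial. -/
theorem eq_one_of_forall_geometricRep_pos {w : W}
    (hw : ∀ i, 0 < geometricRep cs w (simpleRoot i) i) : w = 1 := by
  by_contra hne
  obtain ⟨i, hi⟩ := cs.exists_rightDescent_of_ne_one hne
  have hd := cs.isRightDescent_iff.mp hi
  have h := geometricRep_simpleRoot_nonneg cs (w * cs.simple i) i (by simp; lia) i
  rw [map_mul, Module.End.mul_apply, geometricRep_simple,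
    unitReflection_self (canonicalForm_simpleRoot_self M i), map_neg] at h
  have := hw i
  simp at h
  linarith

theorem geometricRep_injective : Function.Injective (geometricRep cs) := by
  rw [injective_iff_map_eq_one]
  intro w hw
  apply eq_one_of_forall_geometricRep_pos cs
  simp [hw, simpleRoot]

end GeometricRepresentation

section FreeSubgroup

theorem not_commute_freeGroup_pow {m n : ℕ} (hm : m ≠ 0) (hn : n ≠ 0) :
    ¬ Commute ((FreeGroup.of (0 : Fin 2)) ^ m) ((FreeGroup.of (1 : Fin 2)) ^ n) := by
  intro h
  let f : FreeGroup (Fin 2) →* Equiv.Perm ℚ :=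
    FreeGroup.lift ![Equiv.addRight 1, Equiv.mulLeft₀ 2 two_ne_zero]
  have h1 : ∀ (k : ℕ) (x : ℚ), ((Equiv.addRight (1 : ℚ)) ^ k) x = x + k := by
    intro k
    induction k with
    | zero => simp
    | succ k ih => intro x; rw [pow_succ, Equiv.Perm.mul_apply, ih]; simp; ring
  have h2 : ∀ (k : ℕ) (x : ℚ), ((Equiv.mulLeft₀ (2 : ℚ) two_ne_zero) ^ k) x = 2 ^ k * x := by
    intro k
    induction k with
    | zero => simp
    | succ k ih => intro x; rw [pow_succ, Equiv.Perm.mul_apply, ih]; simp; ring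
  have h3 := congrArg (fun g => f g 0) h.eq
  simp only [map_mul, map_pow, f, FreeGroup.lift_apply_of, Matrix.cons_val_zero,
    Matrix.cons_val_one, Equiv.Perm.mul_apply, h1, h2, mul_zero, zero_add] at h3
  have hm' : (m : ℚ) ≠ 0 := by exact_mod_cast hm
  have h4 : (2 : ℚ) ^ n = 1 := by
    field_simp at h3
    exact h3.symm
  have h5 : (1 : ℚ) < 2 ^ n := one_lt_pow₀ (by norm_num) hn
  linarith

theorem not_exists_freeGroup_of_finiteIndex {W : Type*} [Group W] {H : Subgroup W}
    (hH : H.FiniteIndex) (hab : ∀ a ∈ H, ∀ b ∈ H, a * b = b * a) :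
    ¬ ∃ F : Subgroup W, Nonempty (F ≃* FreeGroup (Fin 2)) := by
  rintro ⟨F, ⟨e⟩⟩
  let f : FreeGroup (Fin 2) →* W := F.subtype.comp e.symm.toMonoidHom
  have hf : Function.Injective f := F.subtype_injective.comp e.symm.injective
  obtain ⟨m, hm, -, ha⟩ := Subgroup.exists_pow_mem_of_index_ne_zero hH.index_ne_zero
    (f (FreeGroup.of 0))
  obtain ⟨n, hn, -, hb⟩ := Subgroup.exists_pow_mem_of_index_ne_zero hH.index_ne_zero
    (f (FreeGroup.of 1))
  apply not_commute_freeGroup_pow hm.ne' hn.ne'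
  apply hf
  simpa using hab _ ha _ hb

end FreeSubgroup

section PingPong

open scoped Pointwise

variable {V : Type*} [AddCommGroup V] [Module ℝ V] {Q : LinearMap.BilinForm ℝ V}

theorem unitReflection_conj {f g : Module.End ℝ V} (hf : ∀ v w, Q (f v) (f w) = Q v w)
    (hfg : ∀ v, f (g v) = v) (u : V) :
    Q.unitReflection (f u) = f * Q.unitReflection u * g := by
  ext v
  have h : Q (g v) u = Q v (f u) := by rw [← hf (g v) u, hfg]
  rw [Module.End.mul_apply, Module.End.mul_apply, unitReflection_apply, unitReflection_apply,
    map_sub, map_smul, hfg, h]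

/-- The ping-pong domain of the vector `x k` in a family of vectors. -/
def pingPongSet (Q : LinearMap.BilinForm ℝ V) {ι : Type*} (x : ι → V) (k : ι) : Set V :=
  {p | Q p (x k) < 0 ∧ ∀ l ≠ k, 0 < Q p (x k) + Q p (x l)}

variable {ι : Type*} {x : ι → V}

theorem neg_mem_pingPongSet (hx : ∀ k, Q (x k) (x k) = 1)
    (hxy : ∀ k l, k ≠ l → Q (x k) (x l) < -1) (k : ι) : -x k ∈ pingPongSet Q x k := by
  refine ⟨by simp [hx], fun l hl => ?_⟩
  have := hxy k l hl.symm
  simp only [map_neg, LinearMap.neg_apply, hx]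
  linarith

theorem disjoint_pingPongSet {k l : ι} (hkl : k ≠ l) :
    Disjoint (pingPongSet Q x k) (pingPongSet Q x l) := by
  rw [Set.disjoint_left]
  rintro p ⟨h1, h2⟩ ⟨h3, -⟩
  have := h2 l hkl.symm
  linarith

theorem unitReflection_mem_pingPongSet (hx : ∀ k, Q (x k) (x k) = 1)
    (hxy : ∀ k l, k ≠ l → Q (x k) (x l) < -1) {k l : ι} (hkl : k ≠ l) {p : V}
    (hp : p ∈ pingPongSet Q x l) : Q.unitReflection (x k) p ∈ pingPongSet Q x k := by
  obtain ⟨h1, h2⟩ := hp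
  have hk := h2 k hkl
  refine ⟨?_, fun m hm => ?_⟩
  · simp only [unitReflection_apply, map_sub, map_smul, LinearMap.sub_apply, LinearMap.smul_apply,
      smul_eq_mul, hx]
    linarith
  · simp only [unitReflection_apply, map_sub, map_smul, LinearMap.sub_apply, LinearMap.smul_apply,
      smul_eq_mul, hx]
    have h3 := hxy k m hm.symm
    rcases eq_or_ne m l with rfl | hml
    · nlinarith
    · have := h2 m hml
      nlinarith

theorem injective_lift_of_reflections {W : Type*} [Group W] (ρ : W →* Module.End ℝ V)
    {x : Fin 2 × Bool → V} (hx : ∀ k, Q (x k) (x k) = 1)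
    (hxy : ∀ k l, k ≠ l → Q (x k) (x l) < -1)
    {t : Fin 2 × Bool → W} (ht : ∀ k, ρ (t k) = Q.unitReflection (x k)) :
    Function.Injective (FreeGroup.lift fun i => t (i, true) * t (i, false)) := by
  have htinv : ∀ k, ρ (t k)⁻¹ = Q.unitReflection (x k) := by
    intro k
    calc ρ (t k)⁻¹ = ρ (t k)⁻¹ * (Q.unitReflection (x k) * Q.unitReflection (x k)) := by
          rw [unitReflection_mul_self (hx k), mul_one]
      _ = ρ ((t k)⁻¹ * t k) * Q.unitReflection (x k) := by rw [map_mul, ht, mul_assoc]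
      _ = _ := by rw [inv_mul_cancel, map_one, one_mul]
  let _ : MulAction W V := MulAction.compHom V ρ
  have hsmul : ∀ (w : W) (v : V), w • v = ρ w v := fun _ _ => rfl
  set a : Fin 2 → W := fun i => t (i, true) * t (i, false) with ha
  set Z : Fin 2 → Set V := fun i => pingPongSet Q x (i, true) ∪ pingPongSet Q x (i, false) with hZ
  have hpos : ∀ i l, l ≠ (i, false) → ∀ p ∈ pingPongSet Q x l,
      a i • p ∈ pingPongSet Q x (i, true) := by
    intro i l hl p hp
    simp only [ha, hsmul, map_mul, Module.End.mul_apply, ht]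
    exact unitReflection_mem_pingPongSet hx hxy (by simp)
      (unitReflection_mem_pingPongSet hx hxy hl.symm hp)
  have hneg : ∀ i l, l ≠ (i, true) → ∀ p ∈ pingPongSet Q x l,
      (a i)⁻¹ • p ∈ pingPongSet Q x (i, false) := by
    intro i l hl p hp
    simp only [ha, hsmul, map_mul, Module.End.mul_apply, htinv, mul_inv_rev]
    exact unitReflection_mem_pingPongSet hx hxy (by simp)
      (unitReflection_mem_pingPongSet hx hxy hl.symm hp)
  have hpow : ∀ i l, l ≠ (i, false) → ∀ p ∈ pingPongSet Q x l, ∀ n : ℕ,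
      a i ^ (n + 1) • p ∈ pingPongSet Q x (i, true) := by
    intro i l hl p hp n
    induction n with
    | zero => simpa using hpos i l hl p hp
    | succ n ih => rw [pow_succ', mul_smul]; exact hpos i _ (by simp) _ ih
  have hpow' : ∀ i l, l ≠ (i, true) → ∀ p ∈ pingPongSet Q x l, ∀ n : ℕ,
      (a i)⁻¹ ^ (n + 1) • p ∈ pingPongSet Q x (i, false) := by
    intro i l hl p hp n
    induction n with
    | zero => simpa using hneg i l hl p hp
    | succ n ih => rw [pow_succ', mul_smul]; exact hneg i _ (by simp) _ ih
  have hlift : FreeGroup.lift a =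
      (Monoid.CoprodI.lift fun i => FreeGroup.lift fun _ : Unit => a i).comp
        (freeGroupEquivCoprodI (ι := Fin 2)).toMonoidHom := by
    ext i
    simp
  rw [hlift, MonoidHom.coe_comp]
  refine Function.Injective.comp ?_ (MulEquiv.injective freeGroupEquivCoprodI)
  apply Monoid.CoprodI.lift_injective_of_ping_pong (fun i => FreeGroup.lift fun _ : Unit => a i)
    ?_ Z
  · exact fun i => ⟨_, Or.inl (neg_mem_pingPongSet hx hxy (i, true))⟩
  · intro i j hij
    have hd : ∀ b c, Disjoint (pingPongSet Q x (i, b)) (pingPongSet Q x (j, c)) :=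
      fun b c => disjoint_pingPongSet (by simp [hij])
    simp only [Function.onFun, hZ, Set.disjoint_union_left, Set.disjoint_union_right, hd, and_self]
  · intro i j hij h hne
    obtain ⟨n, rfl⟩ : ∃ n : ℤ, h = FreeGroup.of () ^ n :=
      ⟨_, (FreeGroup.freeGroupUnitEquivInt.symm_apply_apply h).symm⟩
    rw [map_zpow, FreeGroup.lift_apply_of, Set.smul_set_subset_iff]
    intro p hp
    obtain ⟨l, hl, hpl⟩ : ∃ l : Fin 2 × Bool, l.1 = j ∧ p ∈ pingPongSet Q x l := by
      rcases hp with hp | hp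
      · exact ⟨(j, true), rfl, hp⟩
      · exact ⟨(j, false), rfl, hp⟩
    have hli : ∀ b, l ≠ (i, b) := by
      rintro b rfl
      exact hij hl
    obtain ⟨n, rfl | rfl⟩ := n.eq_nat_or_neg
    · rcases n with _ | n
      · simp at hne
      · rw [zpow_natCast]
        exact Or.inl (hpow i l (hli _) p hpl n)
    · rcases n with _ | n
      · simp at hne
      · rw [zpow_neg, zpow_natCast, ← inv_pow]
        exact Or.inr (hpow' i l (hli _) p hpl n)
  · refine Or.inr ⟨0, ?_⟩
    rw [FreeGroup.freeGroupUnitEquivInt.cardinal_eq, Cardinal.mk_denumerable]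
    exact Cardinal.natCast_le_aleph0 (n := 3)

/-- Three reflections in vectors pairwise at hyperbolic distance generate a group which
contains a free group of rank two. -/
theorem exists_freeGroup_of_reflections {W : Type*} [Group W] (ρ : W →* Module.End ℝ V)
    (hQ : Q.IsSymm) {x y z : V} (hx : Q x x = 1) (hy : Q y y = 1) (hz : Q z z = 1)
    (hxy : Q x y < -1) (hxz : Q x z < -1) (hyz : Q y z < -1)
    {a b c : W} (ha : ρ a = Q.unitReflection x) (hb : ρ b = Q.unitReflection y)
    (hc : ρ c = Q.unitReflection z) :
    ∃ H : Subgroup W, Nonempty (H ≃* FreeGroup (Fin 2)) := by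
  set r := Q.unitReflection z with hr
  have hconj : ∀ u, Q.unitReflection (r u) = r * Q.unitReflection u * r :=
    unitReflection_conj (isometry_unitReflection hQ hz) (unitReflection_unitReflection hz)
  have hsym : ∀ u v, Q u v = Q v u := fun u v => hQ.eq u v
  have hiso : ∀ u v, Q (r u) (r v) = Q u v := isometry_unitReflection hQ hz
  have hr1 : ∀ u v, Q u (r v) = Q u v - 2 * Q u z * Q v z := by
    intro u v
    simp only [hr, unitReflection_apply, map_sub, map_smul, smul_eq_mul]
    ring
  have hxx' : Q x (r x) < -1 := by rw [hr1, hx]; nlinarith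
  have hyy' : Q y (r y) < -1 := by rw [hr1, hy]; nlinarith
  have hxy' : Q x (r y) < -1 := by rw [hr1]; nlinarith
  have hyx' : Q y (r x) < -1 := by rw [hr1, hsym y x]; nlinarith
  let X : Fin 2 × Bool → V
    | (0, true) => x
    | (0, false) => y
    | (1, true) => r x
    | (1, false) => r y
  let T : Fin 2 × Bool → W
    | (0, true) => a
    | (0, false) => b
    | (1, true) => c * a * c
    | (1, false) => c * b * c
  have hX : ∀ k, Q (X k) (X k) = 1 := by
    rintro ⟨i, _ | _⟩ <;> fin_cases i <;> simp [X, hx, hy, hiso]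
  have hXX : ∀ k l, k ≠ l → Q (X k) (X l) < -1 := by
    rintro ⟨i, _ | _⟩ ⟨j, _ | _⟩ <;> fin_cases i <;> fin_cases j <;> intro h <;>
      first
      | exact absurd rfl h
      | simpa only [X, hiso]
      | (simp only [X, hiso]; rw [hsym]; assumption)
  have hT : ∀ k, ρ (T k) = Q.unitReflection (X k) := by
    rintro ⟨i, _ | _⟩ <;> fin_cases i <;> simp [X, T, ha, hb, hc, hconj]
  have hinj := injective_lift_of_reflections ρ hX hXX hT
  exact ⟨_, ⟨(MonoidHom.ofInjective hinj).symm⟩⟩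

end PingPong

section Roots

open Filter Topology

variable {B : Type*} [Fintype B] [DecidableEq B] {M : CoxeterMatrix B}

theorem abs_canonicalForm_simpleRoot_le (i j : B) :
    |canonicalForm M (simpleRoot i) (simpleRoot j)| ≤ 1 := by
  rw [canonicalForm_simpleRoot, abs_neg]
  exact Real.abs_cos_le_one _

theorem norm_simpleRoot (i : B) : ‖simpleRoot i‖ = 1 := by
  simp [simpleRoot, Pi.norm_single]

theorem canonicalForm_eq_sum (v : B → ℝ) (w : B → ℝ) :
    canonicalForm M v w = ∑ i, v i * canonicalForm M (simpleRoot i) w := by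
  conv_lhs => rw [eq_sum_simpleRoot v]
  simp

theorem abs_canonicalForm_simpleRoot_left_le (i : B) (v : B → ℝ) :
    |canonicalForm M (simpleRoot i) v| ≤ Fintype.card B * ‖v‖ := by
  rw [canonicalForm_comm, canonicalForm_eq_sum]
  refine (Finset.abs_sum_le_sum_abs _ _).trans ?_
  rw [← nsmul_eq_mul]
  refine Finset.sum_le_card_nsmul _ _ _ fun j _ => ?_
  rw [abs_mul]
  exact (mul_le_of_le_one_right (abs_nonneg _) (abs_canonicalForm_simpleRoot_le j i)).trans
    (norm_le_pi_norm v j)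

theorem continuous_canonicalForm :
    Continuous fun p : (B → ℝ) × (B → ℝ) => canonicalForm M p.1 p.2 := by
  have h : (fun p : (B → ℝ) × (B → ℝ) => canonicalForm M p.1 p.2) = fun p => ∑ i, ∑ j,
      p.1 i * (p.2 j * canonicalForm M (simpleRoot j) (simpleRoot i)) := by
    ext p
    rw [canonicalForm_eq_sum]
    refine Finset.sum_congr rfl fun i _ => ?_
    rw [canonicalForm_comm, canonicalForm_eq_sum, Finset.mul_sum]
  rw [h]
  fun_prop

section Discrete

variable {W : Type*} [Group W] (cs : CoxeterSystem M W)

/-- The image of the geometric representation is discrete. -/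
theorem finite_of_norm_geometricRep_le {S : Set W} {R : ℝ}
    (hS : ∀ w ∈ S, ∀ i, ‖geometricRep cs w (simpleRoot i)‖ ≤ R)
    (hS' : ∀ w ∈ S, ∀ i, ‖geometricRep cs w⁻¹ (simpleRoot i)‖ ≤ R) : S.Finite := by
  by_contra hinf
  let u := Set.Infinite.natEmbedding S hinf
  let F : ℕ → (B → B → ℝ) × (B → B → ℝ) := fun n =>
    (fun i => geometricRep cs (u n : W) (simpleRoot i),
      fun i => geometricRep cs (u n : W)⁻¹ (simpleRoot i))
  have hR : ∀ i : B, 0 ≤ R := fun i => (norm_nonneg _).trans (hS _ (u 0).2 i)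
  have hF : ∀ n, F n ∈ Metric.closedBall (0 : (B → B → ℝ) × (B → B → ℝ)) (max R 0) := by
    intro n
    rw [mem_closedBall_zero_iff, norm_prod_le_iff, pi_norm_le_iff_of_nonneg (le_max_right _ _),
      pi_norm_le_iff_of_nonneg (le_max_right _ _)]
    exact ⟨fun i => (hS _ (u n).2 i).trans (le_max_left _ _),
      fun i => (hS' _ (u n).2 i).trans (le_max_left _ _)⟩
  obtain ⟨L, -, φ, hφ, hL⟩ := (isCompact_closedBall _ _).tendsto_subseq hF
  have hprod : ∀ (w w' : W) (i : B), geometricRep cs (w⁻¹ * w') (simpleRoot i) i =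
      ∑ j, geometricRep cs w' (simpleRoot i) j * geometricRep cs w⁻¹ (simpleRoot j) i := by
    intro w w' i
    rw [map_mul, Module.End.mul_apply]
    conv_lhs => rw [eq_sum_simpleRoot (geometricRep cs w' (simpleRoot i))]
    simp
  have hcont : Continuous fun p : ((B → B → ℝ) × (B → B → ℝ)) × ((B → B → ℝ) × (B → B → ℝ)) =>
      fun i => ∑ j, p.1.1 i j * p.2.2 j i := by fun_prop
  have hlim : ∀ ψ : ℕ → ℕ, Tendsto ψ atTop atTop → Tendsto
      (fun n i => geometricRep cs ((u (φ n) : W)⁻¹ * u (φ (ψ n))) (simpleRoot i) i) atTop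
      (𝓝 fun i => ∑ j, L.1 i j * L.2 j i) := by
    intro ψ hψ
    refine ((hcont.tendsto (L, L)).comp ((hL.comp hψ).prodMk_nhds hL)).congr fun n => ?_
    ext i
    rw [hprod]
    rfl
  have hone : (fun i => ∑ j, L.1 i j * L.2 j i) = fun _ : B => (1 : ℝ) := by
    refine tendsto_nhds_unique (hlim id tendsto_id) ?_
    simp [simpleRoot]
  have h1 := hlim (fun n => n + 1) (tendsto_add_atTop_nat 1)
  rw [hone, tendsto_pi_nhds] at h1
  have h2 : ∀ᶠ n in atTop, ∀ i : B,
      0 < geometricRep cs ((u (φ n) : W)⁻¹ * u (φ (n + 1))) (simpleRoot i) i :=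
    eventually_all.mpr fun i => (h1 i).eventually_const_lt zero_lt_one
  obtain ⟨n, hn⟩ := h2.exists
  have h3 := eq_one_of_forall_geometricRep_pos cs hn
  rw [inv_mul_eq_one] at h3
  have h4 := hφ.injective (u.injective (Subtype.ext h3))
  lia

end Discrete

/-- The roots of the standard parabolic subsystem supported on `J`. -/
inductive IsRoot (M : CoxeterMatrix B) (J : Set B) : (B → ℝ) → Prop
  | simple {i : B} : i ∈ J → IsRoot M J (simpleRoot i)
  | reflect {j : B} {α : B → ℝ} : j ∈ J → IsRoot M J α →
      IsRoot M J ((canonicalForm M).unitReflection (simpleRoot j) α)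

variable {J : Set B} {α β : B → ℝ}

theorem IsRoot.canonicalForm_self (h : IsRoot M J α) : canonicalForm M α α = 1 := by
  induction h with
  | simple _ => exact canonicalForm_simpleRoot_self M _
  | reflect _ _ ih =>
    rw [isometry_unitReflection (canonicalForm_isSymm M) (canonicalForm_simpleRoot_self M _), ih]

theorem IsRoot.neg (h : IsRoot M J α) : IsRoot M J (-α) := by
  induction h with
  | simple hi =>
    rw [← unitReflection_self (canonicalForm_simpleRoot_self M _)]
    exact .reflect hi (.simple hi)
  | reflect hj _ ih => rw [← map_neg]; exact .reflect hj ih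

theorem IsRoot.apply_eq_zero (h : IsRoot M J α) {k : B} (hk : k ∉ J) : α k = 0 := by
  have hs : ∀ i ∈ J, simpleRoot i k = 0 := by
    intro i hi
    rw [simpleRoot, Pi.single_eq_of_ne]
    rintro rfl
    exact hk hi
  induction h with
  | simple hi => exact hs _ hi
  | reflect hj _ ih => simp [unitReflection_apply, ih, hs _ hj]

variable {W : Type*} [Group W] (cs : CoxeterSystem M W)

theorem IsRoot.exists_reflection (h : IsRoot M J α) :
    ∃ t : W, t⁻¹ = t ∧ geometricRep cs t = (canonicalForm M).unitReflection α := by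
  induction h with
  | @simple i hi => exact ⟨cs.simple i, cs.inv_simple i, geometricRep_simple cs i⟩
  | @reflect j α hj _ ih =>
    obtain ⟨t, ht, htα⟩ := ih
    refine ⟨cs.simple j * t * cs.simple j, by simp [ht, mul_assoc], ?_⟩
    rw [unitReflection_conj (isometry_unitReflection (canonicalForm_isSymm M)
      (canonicalForm_simpleRoot_self M j))
      (unitReflection_unitReflection (canonicalForm_simpleRoot_self M j)), map_mul, map_mul, htα,
      geometricRep_simple]

theorem isRoot_geometricRep (w : W) (i : B) :
    IsRoot M Set.univ (geometricRep cs w (simpleRoot i)) := by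
  induction w using cs.simple_induction_left with
  | one => simpa using IsRoot.simple (Set.mem_univ i)
  | mul_simple_left w j ih =>
    rw [map_mul, Module.End.mul_apply, geometricRep_simple]
    exact .reflect (Set.mem_univ j) ih

theorem IsRoot.eq_or_eq_neg (hα : IsRoot M J α) (hβ : IsRoot M J β)
    (h : (canonicalForm M).unitReflection α = (canonicalForm M).unitReflection β) :
    α = β ∨ α = -β := by
  have h1 := LinearMap.congr_fun h α
  rw [unitReflection_self hα.canonicalForm_self, unitReflection_apply] at h1
  have h2 : α = canonicalForm M α β • β := by
    have : (2 : ℝ) • α = (2 : ℝ) • (canonicalForm M α β • β) := by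
      calc (2 : ℝ) • α = α - -α := by module
        _ = _ := by rw [h1]; module
    exact smul_right_injective _ (two_ne_zero' ℝ) this
  have h3 := hα.canonicalForm_self
  rw [h2] at h3
  simp only [map_smul, LinearMap.smul_apply, hβ.canonicalForm_self, smul_eq_mul, mul_one] at h3
  rcases mul_self_eq_one_iff.mp h3 with h | h
  · left; rw [h2, h, one_smul]
  · right; rw [h2, h, neg_one_smul]

include cs in
theorem finite_of_isRoot_of_norm_le {S : Set (B → ℝ)} (hS : ∀ α ∈ S, IsRoot M J α) {R : ℝ}
    (hR : ∀ α ∈ S, ‖α‖ ≤ R) : S.Finite := by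
  have hex : ∀ α, ∃ t : W, α ∈ S →
      t⁻¹ = t ∧ geometricRep cs t = (canonicalForm M).unitReflection α := by
    intro α
    by_cases h : α ∈ S
    · obtain ⟨t, ht⟩ := (hS α h).exists_reflection cs
      exact ⟨t, fun _ => ht⟩
    · exact ⟨1, fun h' => absurd h' h⟩
  choose t ht using hex
  have hbound : ∀ α ∈ S, ∀ i, ‖geometricRep cs (t α) (simpleRoot i)‖ ≤
      1 + 2 * (Fintype.card B * R) * R := by
    intro α hα i
    have hR0 : 0 ≤ R := (norm_nonneg _).trans (hR α hα)
    rw [(ht α hα).2, unitReflection_apply]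
    refine (norm_sub_le _ _).trans ?_
    rw [norm_simpleRoot, norm_smul, norm_mul, Real.norm_eq_abs, Real.norm_eq_abs, abs_two]
    have := abs_canonicalForm_simpleRoot_left_le (M := M) i α
    have := hR α hα
    gcongr
    exact (abs_canonicalForm_simpleRoot_left_le i α).trans (by gcongr)
  have hfin : (t '' S).Finite := by
    apply finite_of_norm_geometricRep_le cs (R := 1 + 2 * (Fintype.card B * R) * R)
    · rintro _ ⟨α, hα, rfl⟩ i
      exact hbound α hα i
    · rintro _ ⟨α, hα, rfl⟩ i
      rw [(ht α hα).1]
      exact hbound α hα i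
  refine Set.Finite.of_finite_fibers t hfin ?_
  rintro _ ⟨α, hα, rfl⟩
  refine (Set.toFinite {α, -α}).subset ?_
  rintro β ⟨hβ, hβα⟩
  apply (hS β hβ).eq_or_eq_neg (hS α hα)
  rw [← (ht β hβ).2, ← (ht α hα).2, hβα]

end Roots

section Indefinite

open Filter Topology

variable {B : Type*} [Fintype B] [DecidableEq B] {M : CoxeterMatrix B} {J : Set B}

/-- The form is nonnegative on the span of the simple roots if there are only finitely many
roots. -/
theorem canonicalForm_self_nonneg_of_finite (hfin : {α | IsRoot M J α}.Finite) {z : B → ℝ}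
    (hz : ∀ i ∉ J, z i = 0) : 0 ≤ canonicalForm M z z := by
  set Q := canonicalForm M with hQ
  set Γ := hfin.toFinset with hΓ
  have hmem : ∀ γ, γ ∈ Γ ↔ IsRoot M J γ := fun γ => by simp [hΓ]
  let κ : B → ℝ := fun i => ∑ γ ∈ Γ, Q (simpleRoot i) γ ^ 2
  have key : ∀ i ∈ J, ∑ γ ∈ Γ, Q (simpleRoot i) γ • γ = κ i • simpleRoot i := by
    intro i hi
    set r := Q.unitReflection (simpleRoot i) with hr
    have hself : Q (simpleRoot i) (simpleRoot i) = 1 := canonicalForm_simpleRoot_self M i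
    have hrr : ∀ v, r (r v) = v := unitReflection_unitReflection hself
    have h1 : r (∑ γ ∈ Γ, Q (simpleRoot i) γ • γ) = -∑ γ ∈ Γ, Q (simpleRoot i) γ • γ := by
      rw [map_sum, ← Finset.sum_neg_distrib]
      refine Finset.sum_nbij' r r ?_ ?_ (fun _ _ => hrr _) (fun _ _ => hrr _) ?_
      · intro γ hγ
        rw [hmem] at hγ ⊢
        exact .reflect hi hγ
      · intro γ hγ
        rw [hmem] at hγ ⊢
        exact .reflect hi hγ
      · intro γ _
        rw [map_smul, ← neg_smul]
        congr 1
        have := isometry_unitReflection (canonicalForm_isSymm M) hself (simpleRoot i) γ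
        rw [← this, ← hQ, ← hr, hr, unitReflection_self hself, map_neg, LinearMap.neg_apply]
    rw [hr, unitReflection_apply] at h1
    have h2 : (2 : ℝ) • ∑ γ ∈ Γ, Q (simpleRoot i) γ • γ = (2 : ℝ) • κ i • simpleRoot i := by
      have h3 : κ i = Q (∑ γ ∈ Γ, Q (simpleRoot i) γ • γ) (simpleRoot i) := by
        rw [map_sum, LinearMap.sum_apply]
        refine Finset.sum_congr rfl fun γ _ => ?_
        rw [map_smul, LinearMap.smul_apply, smul_eq_mul, sq]
        congr 1
        exact canonicalForm_comm M _ _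
      rw [h3, smul_smul]
      rw [sub_eq_iff_eq_add] at h1
      nth_rewrite 1 [two_smul]
      nth_rewrite 1 [h1]
      abel
    exact smul_right_injective _ (two_ne_zero' ℝ) h2
  have hκ : ∀ i ∈ J, 0 < κ i := by
    intro i hi
    refine Finset.sum_pos' (fun _ _ => sq_nonneg _)
      ⟨simpleRoot i, (hmem _).mpr (.simple hi), ?_⟩
    rw [hQ, canonicalForm_simpleRoot_self]
    norm_num
  have hsum : ∀ i ∈ J, ∀ v, ∑ γ ∈ Γ, Q (simpleRoot i) γ * Q v γ = κ i * Q v (simpleRoot i) := by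
    intro i hi v
    have := congrArg (Q v) (key i hi)
    simpa [map_sum] using this
  have hcomm : ∀ i ∈ J, ∀ j ∈ J,
      κ i * Q (simpleRoot i) (simpleRoot j) = κ j * Q (simpleRoot i) (simpleRoot j) := by
    intro i hi j hj
    rw [← hsum j hj, hQ, canonicalForm_comm M (simpleRoot i), ← hQ, ← hsum i hi]
    exact Finset.sum_congr rfl fun _ _ => mul_comm _ _
  have hpos : 0 ≤ ∑ γ ∈ Γ, (∑ i, z i / √(κ i) * Q (simpleRoot i) γ) ^ 2 :=
    Finset.sum_nonneg fun _ _ => sq_nonneg _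
  refine hpos.trans_eq ?_
  calc ∑ γ ∈ Γ, (∑ i, z i / √(κ i) * Q (simpleRoot i) γ) ^ 2
      = ∑ i, ∑ j, z i / √(κ i) * (z j / √(κ j)) *
        ∑ γ ∈ Γ, Q (simpleRoot i) γ * Q (simpleRoot j) γ := by
        simp_rw [sq, Finset.sum_mul_sum, Finset.mul_sum]
        rw [Finset.sum_comm]
        refine Finset.sum_congr rfl fun i _ => ?_
        rw [Finset.sum_comm]
        refine Finset.sum_congr rfl fun j _ => Finset.sum_congr rfl fun γ _ => ?_
        ring
    _ = ∑ i, ∑ j, z i * (z j * Q (simpleRoot j) (simpleRoot i)) := by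
        refine Finset.sum_congr rfl fun i _ => Finset.sum_congr rfl fun j _ => ?_
        by_cases hi : i ∈ J
        swap
        · simp [hz i hi]
        by_cases hj : j ∈ J
        swap
        · simp [hz j hj]
        rw [hsum i hi]
        have h := hcomm j hj i hi
        rcases mul_eq_mul_right_iff.mp h with h | h
        · have h1 := Real.mul_self_sqrt (hκ i hi).le
          have h2 := Real.sqrt_pos.mpr (hκ i hi)
          rw [h]
          field_simp
          rw [sq, h1]
          ring
        · simp [h]
    _ = Q z z := by
        rw [hQ, canonicalForm_eq_sum]
        refine Finset.sum_congr rfl fun i _ => ?_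
        rw [canonicalForm_comm, canonicalForm_eq_sum, Finset.mul_sum]

/-- Limits of directions of roots going to infinity. -/
def IsLimitRoot (M : CoxeterMatrix B) (J : Set B) (ξ : B → ℝ) : Prop :=
  ∃ (α : ℕ → B → ℝ) (t : ℕ → ℝ), (∀ n, IsRoot M J (α n)) ∧ (∀ n, 0 < t n) ∧
    Tendsto t atTop (𝓝 0) ∧ Tendsto (fun n => t n • α n) atTop (𝓝 ξ)

variable {ξ η : B → ℝ}

theorem IsLimitRoot.reflect (h : IsLimitRoot M J ξ) {j : B} (hj : j ∈ J) :
    IsLimitRoot M J ((canonicalForm M).unitReflection (simpleRoot j) ξ) := by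
  obtain ⟨α, t, hα, ht, ht0, hlim⟩ := h
  refine ⟨fun n => (canonicalForm M).unitReflection (simpleRoot j) (α n), t,
    fun n => .reflect hj (hα n), ht, ht0, ?_⟩
  have := ((LinearMap.continuous_of_finiteDimensional
    ((canonicalForm M).unitReflection (simpleRoot j))).tendsto ξ).comp hlim
  refine this.congr fun n => ?_
  simp

theorem IsLimitRoot.apply_eq_zero (h : IsLimitRoot M J ξ) {k : B} (hk : k ∉ J) : ξ k = 0 := by
  obtain ⟨α, t, hα, -, -, hlim⟩ := h
  refine tendsto_nhds_unique (tendsto_pi_nhds.mp hlim k) ?_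
  simp [(hα _).apply_eq_zero hk]

theorem tendsto_canonicalForm {u v : ℕ → B → ℝ} (hu : Tendsto u atTop (𝓝 ξ))
    (hv : Tendsto v atTop (𝓝 η)) :
    Tendsto (fun n => canonicalForm M (u n) (v n)) atTop (𝓝 (canonicalForm M ξ η)) := by
  have h1 : Tendsto (fun p : (B → ℝ) × (B → ℝ) => canonicalForm M p.1 p.2) (𝓝 (ξ, η))
    (𝓝 (canonicalForm M ξ η)) := continuous_canonicalForm.tendsto (ξ, η)
  exact (h1.comp (hu.prodMk_nhds hv)).congr fun _ => rfl

theorem IsLimitRoot.canonicalForm_self (h : IsLimitRoot M J ξ) : canonicalForm M ξ ξ = 0 := by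
  obtain ⟨α, t, hα, -, ht0, hlim⟩ := h
  refine tendsto_nhds_unique (tendsto_canonicalForm hlim hlim) ?_
  simpa [(hα _).canonicalForm_self] using ht0.mul ht0

theorem eventually_canonicalForm_lt_neg_one {α β : ℕ → B → ℝ} {s t : ℕ → ℝ}
    (hs : ∀ n, 0 < s n) (ht : ∀ n, 0 < t n) (hs0 : Tendsto s atTop (𝓝 0))
    (ht0 : Tendsto t atTop (𝓝 0)) (hα : Tendsto (fun n => s n • α n) atTop (𝓝 ξ))
    (hβ : Tendsto (fun n => t n • β n) atTop (𝓝 η)) (hneg : canonicalForm M ξ η < 0) :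
    ∀ᶠ n in atTop, canonicalForm M (α n) (β n) < -1 := by
  have h := (tendsto_canonicalForm (M := M) hα hβ).add (hs0.mul ht0)
  simp only [mul_zero, add_zero, map_smul, LinearMap.smul_apply, smul_eq_mul] at h
  filter_upwards [h.eventually_lt_const hneg] with n hn
  have h1 : s n * t n * (canonicalForm M (α n) (β n) + 1) < 0 := by linarith
  have h2 := neg_of_mul_neg_right h1 (mul_pos (hs n) (ht n)).le
  linarith

variable {W : Type*} [Group W] (cs : CoxeterSystem M W)

include cs in
theorem exists_isLimitRoot (hinf : ¬ {α | IsRoot M J α}.Finite) :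
    ∃ ξ, ξ ≠ 0 ∧ IsLimitRoot M J ξ := by
  have hunb : ∀ n : ℕ, ∃ α, IsRoot M J α ∧ (n : ℝ) + 1 < ‖α‖ := by
    intro n
    by_contra! hcon
    exact hinf (finite_of_isRoot_of_norm_le cs (fun α hα => hα) hcon)
  choose α hα hn using hunb
  have hpos : ∀ n, 0 < ‖α n‖ := fun n => lt_trans (by positivity) (hn n)
  have hsph : ∀ n, ‖α n‖⁻¹ • α n ∈ Metric.sphere (0 : B → ℝ) 1 := by
    intro n
    rw [mem_sphere_zero_iff_norm, norm_smul, norm_inv, norm_norm, inv_mul_cancel₀ (hpos n).ne']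
  obtain ⟨ξ, hξ, φ, hφ, hlim⟩ := (isCompact_sphere _ _).tendsto_subseq hsph
  refine ⟨ξ, ?_, fun n => α (φ n), fun n => ‖α (φ n)‖⁻¹, fun n => hα _, fun n => inv_pos.mpr (hpos _),
    ?_, hlim⟩
  · rintro rfl
    simp at hξ
  · apply Tendsto.inv_tendsto_atTop
    refine Tendsto.comp (g := fun n => ‖α n‖) ?_ hφ.tendsto_atTop
    exact tendsto_atTop_mono (fun n => by linarith [hn n]) tendsto_natCast_atTop_atTop

include cs in
theorem exists_freeGroup_of_isLimitRoot {ζ : B → ℝ} (hξ : IsLimitRoot M J ξ)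
    (hη : IsLimitRoot M J η) (hζ : IsLimitRoot M J ζ) (h1 : canonicalForm M ξ η < 0)
    (h2 : canonicalForm M ξ ζ < 0) (h3 : canonicalForm M η ζ < 0) :
    ∃ H : Subgroup W, Nonempty (H ≃* FreeGroup (Fin 2)) := by
  obtain ⟨α, s, hα, hs, hs0, hαξ⟩ := hξ
  obtain ⟨β, t, hβ, ht, ht0, hβη⟩ := hη
  obtain ⟨γ, u, hγ, hu, hu0, hγζ⟩ := hζ
  obtain ⟨n, hn1, hn2, hn3⟩ := ((eventually_canonicalForm_lt_neg_one hs ht hs0 ht0 hαξ hβη h1).and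
    ((eventually_canonicalForm_lt_neg_one hs hu hs0 hu0 hαξ hγζ h2).and
    (eventually_canonicalForm_lt_neg_one ht hu ht0 hu0 hβη hγζ h3))).exists
  obtain ⟨a, -, ha⟩ := (hα n).exists_reflection cs
  obtain ⟨b, -, hb⟩ := (hβ n).exists_reflection cs
  obtain ⟨c, -, hc⟩ := (hγ n).exists_reflection cs
  exact exists_freeGroup_of_reflections (geometricRep cs) (canonicalForm_isSymm M)
    (hα n).canonicalForm_self (hβ n).canonicalForm_self (hγ n).canonicalForm_self hn1 hn2 hn3
    ha hb hc

/-- `z` is a negative vector supported on `J`, and no negative vector has smaller support. -/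
structure IsMinimalNegative (M : CoxeterMatrix B) (J : Set B) (z : B → ℝ) : Prop where
  apply_eq_zero : ∀ i ∉ J, z i = 0
  neg : canonicalForm M z z < 0
  nonneg : ∀ v : B → ℝ, (∀ i ∉ J, v i = 0) → (∃ i ∈ J, v i = 0) → 0 ≤ canonicalForm M v v

theorem exists_isMinimalNegative {z : B → ℝ} (hz : canonicalForm M z z < 0) :
    ∃ J z, IsMinimalNegative M J z := by
  obtain ⟨J, ⟨z, hzJ, hz⟩, hmin⟩ := WellFounded.has_min (wellFounded_lt (α := Finset B))
    {J | ∃ z : B → ℝ, (∀ i ∉ J, z i = 0) ∧ canonicalForm M z z < 0} ⟨Finset.univ, z, by simp, hz⟩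
  refine ⟨J, z, hzJ, hz, ?_⟩
  rintro v hv ⟨i, hi, hvi⟩
  by_contra! hneg
  refine hmin (J.erase i) ⟨v, fun k hk => ?_, hneg⟩ (Finset.erase_ssubset hi)
  rw [Finset.mem_erase, not_and_or, not_not] at hk
  rcases hk with rfl | hk
  · exact hvi
  · exact hv k hk

namespace IsMinimalNegative

variable {z : B → ℝ} (h : IsMinimalNegative M J z)

include h

theorem pos_of_orthogonal {y : B → ℝ} (hy : ∀ i ∉ J, y i = 0) (hyz : canonicalForm M y z = 0)
    (hy0 : y ≠ 0) : 0 < canonicalForm M y y := by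
  obtain ⟨i, hi⟩ := Function.ne_iff.mp hy0
  have hiJ : i ∈ J := by
    by_contra hcon
    exact hi (hy i hcon)
  have hzi : z i ≠ 0 := fun h0 => (h.nonneg z h.apply_eq_zero ⟨i, hiJ, h0⟩).not_gt h.neg
  have h1 := h.nonneg (y - (y i / z i) • z) (fun k hk => by simp [hy k hk, h.apply_eq_zero k hk])
    ⟨i, hiJ, by simp [hzi]⟩
  have hzy : canonicalForm M z y = 0 := by rw [canonicalForm_comm, hyz]
  simp only [map_sub, map_smul, LinearMap.sub_apply, LinearMap.smul_apply, smul_eq_mul, hyz, hzy]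
    at h1
  have hc : 0 < (y i / z i) ^ 2 := by
    have : y i / z i ≠ 0 := div_ne_zero hi hzi
    positivity
  nlinarith [h.neg, mul_neg_of_pos_of_neg hc h.neg]

theorem exists_ne_zero {v : B → ℝ} (hv : ∀ i ∉ J, v i = 0) (hv0 : v ≠ 0) :
    ∃ i ∈ J, canonicalForm M v (simpleRoot i) ≠ 0 := by
  by_contra! hcon
  have hall : ∀ u : B → ℝ, (∀ i ∉ J, u i = 0) → canonicalForm M v u = 0 := by
    intro u hu
    rw [canonicalForm_comm, canonicalForm_eq_sum]
    refine Finset.sum_eq_zero fun i _ => ?_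
    by_cases hi : i ∈ J
    · rw [canonicalForm_comm, hcon i hi, mul_zero]
    · rw [hu i hi, zero_mul]
  exact (h.pos_of_orthogonal hv (hall z h.apply_eq_zero) hv0).ne' (hall v hv)

/-- The reversed Cauchy-Schwarz inequality for isotropic vectors. -/
theorem mul_neg_of_isotropic (hξ : ∀ i ∉ J, ξ i = 0) (hη : ∀ i ∉ J, η i = 0)
    (hξξ : canonicalForm M ξ ξ = 0) (hηη : canonicalForm M η η = 0)
    (hne : canonicalForm M η z • ξ ≠ canonicalForm M ξ z • η) :
    canonicalForm M ξ z * canonicalForm M η z * canonicalForm M ξ η < 0 := by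
  have h1 := h.pos_of_orthogonal (y := canonicalForm M η z • ξ - canonicalForm M ξ z • η)
    (fun i hi => by simp [hξ i hi, hη i hi])
    (by
      simp only [map_sub, map_smul, LinearMap.sub_apply, LinearMap.smul_apply, smul_eq_mul]
      ring)
    (sub_ne_zero.mpr hne)
  simp only [map_sub, map_smul, LinearMap.sub_apply, LinearMap.smul_apply, smul_eq_mul, hξξ, hηη,
    canonicalForm_comm M η ξ] at h1
  linarith

theorem canonicalForm_neg_of_isotropic {ζ : B → ℝ} (hξ : ∀ i ∉ J, ξ i = 0)
    (hη : ∀ i ∉ J, η i = 0) (hζ : ∀ i ∉ J, ζ i = 0) (hξξ : canonicalForm M ξ ξ = 0)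
    (hηη : canonicalForm M η η = 0) (hζζ : canonicalForm M ζ ζ = 0)
    (hξη : canonicalForm M ξ η < 0) (hξζ : canonicalForm M ξ ζ < 0)
    (hne : ∀ a b : ℝ, a ≠ 0 → b ≠ 0 → a • η ≠ b • ζ) : canonicalForm M η ζ < 0 := by
  have hz0 : ∀ v : B → ℝ, (∀ i ∉ J, v i = 0) → canonicalForm M v v = 0 → v ≠ 0 →
      canonicalForm M v z ≠ 0 := fun v hv hvv hv0 h0 => (h.pos_of_orthogonal hv h0 hv0).ne' hvv
  have hp := hz0 ξ hξ hξξ (by rintro rfl; simp at hξη)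
  have hq := hz0 η hη hηη (by rintro rfl; simp at hξη)
  have hr := hz0 ζ hζ hζζ (by rintro rfl; simp at hξζ)
  have hlin : ∀ v : B → ℝ, canonicalForm M ξ v < 0 →
      canonicalForm M v z • ξ ≠ canonicalForm M ξ z • v := by
    intro v hv heq
    have := congrArg (canonicalForm M ξ) heq
    simp only [map_smul, hξξ, smul_eq_mul, mul_zero] at this
    exact mul_ne_zero hp hv.ne this.symm
  have h1 := h.mul_neg_of_isotropic hξ hη hξξ hηη (hlin η hξη)
  have h2 := h.mul_neg_of_isotropic hξ hζ hξξ hζζ (hlin ζ hξζ)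
  have h3 := h.mul_neg_of_isotropic hη hζ hηη hζζ (hne _ _ hr hq)
  have h4 := pos_of_mul_neg_left h1 hξη.le
  have h5 := pos_of_mul_neg_left h2 hξζ.le
  have h6 : 0 < canonicalForm M η z * canonicalForm M ζ z := by
    have := mul_pos h4 h5
    have hp2 : 0 < canonicalForm M ξ z ^ 2 := by positivity
    refine pos_of_mul_pos_right (a := canonicalForm M ξ z ^ 2) ?_ hp2.le
    linarith
  exact neg_of_mul_neg_right h3 h6.le

include cs in
theorem exists_freeGroup_of_ne_zero (hξ : IsLimitRoot M J ξ) {i j : B} (hi : i ∈ J) (hj : j ∈ J)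
    (hij : i ≠ j) (hξi : canonicalForm M ξ (simpleRoot i) ≠ 0)
    (hξj : canonicalForm M ξ (simpleRoot j) ≠ 0) :
    ∃ H : Subgroup W, Nonempty (H ≃* FreeGroup (Fin 2)) := by
  have hη := hξ.reflect hi
  have hζ := hξ.reflect hj
  have hQ : ∀ k, canonicalForm M ξ (simpleRoot k) ≠ 0 →
      canonicalForm M ξ ((canonicalForm M).unitReflection (simpleRoot k) ξ) < 0 := by
    intro k hk
    simp only [unitReflection_apply, map_sub, map_smul, hξ.canonicalForm_self, smul_eq_mul]
    have : 0 < canonicalForm M ξ (simpleRoot k) ^ 2 := by positivity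
    linarith
  refine exists_freeGroup_of_isLimitRoot cs hξ hη hζ (hQ i hξi) (hQ j hξj)
    (h.canonicalForm_neg_of_isotropic (fun _ => hξ.apply_eq_zero) (fun _ => hη.apply_eq_zero)
      (fun _ => hζ.apply_eq_zero) hξ.canonicalForm_self hη.canonicalForm_self
      hζ.canonicalForm_self (hQ i hξi) (hQ j hξj) ?_)
  intro a b ha hb hab
  rw [unitReflection_apply, unitReflection_apply] at hab
  set p := canonicalForm M ξ (simpleRoot i) with hp
  set q := canonicalForm M ξ (simpleRoot j) with hq
  have hei : simpleRoot i i = (1 : ℝ) := by simp [simpleRoot]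
  have hej : simpleRoot j i = (0 : ℝ) := by simp [simpleRoot, hij]
  have hab' : (a - b) • ξ = (2 * a * p) • simpleRoot i - (2 * b * q) • simpleRoot j := by
    have : (a - b) • ξ = a • (ξ - (2 * p) • simpleRoot i) - b • (ξ - (2 * q) • simpleRoot j) +
        ((2 * a * p) • simpleRoot i - (2 * b * q) • simpleRoot j) := by module
    rw [this, hab, sub_self, zero_add]
  have hne : a - b ≠ 0 := by
    intro h0
    have := congrFun hab' i
    simp only [h0, zero_mul, Pi.sub_apply, Pi.smul_apply, hei, hej, smul_eq_mul, mul_one, mul_zero,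
      sub_zero] at this
    exact mul_ne_zero (mul_ne_zero two_ne_zero ha) hξi this.symm
  obtain ⟨c, d, hcd⟩ : ∃ c d : ℝ, ξ = c • simpleRoot i + d • simpleRoot j := by
    refine ⟨2 * a * p / (a - b), -(2 * b * q) / (a - b), ?_⟩
    apply smul_right_injective _ hne
    simp only [smul_add, smul_smul, hab']
    rw [mul_div_cancel₀ _ hne, mul_div_cancel₀ _ hne]
    module
  have hpsd : ∀ x y : ℝ, 0 ≤ canonicalForm M (x • simpleRoot i + y • simpleRoot j)
      (x • simpleRoot i + y • simpleRoot j) := by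
    intro x y
    have h1 := abs_le.mp (abs_canonicalForm_simpleRoot_le (M := M) i j)
    simp only [map_add, map_smul, LinearMap.add_apply, LinearMap.smul_apply, smul_eq_mul,
      canonicalForm_simpleRoot_self, canonicalForm_comm M (simpleRoot j) (simpleRoot i)]
    nlinarith [sq_nonneg (x + y), sq_nonneg (x - y)]
  have h1 : ξ - p • simpleRoot i = (c - p) • simpleRoot i + d • simpleRoot j := by
    rw [hcd]; module
  have h2 := hpsd (c - p) d
  rw [← h1] at h2
  simp only [map_sub, map_smul, LinearMap.sub_apply, LinearMap.smul_apply, smul_eq_mul,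
    hξ.canonicalForm_self, canonicalForm_simpleRoot_self, canonicalForm_comm M (simpleRoot i) ξ,
    ← hp] at h2
  have : 0 < p ^ 2 := by positivity
  linarith

include cs in
theorem exists_freeGroup : ∃ H : Subgroup W, Nonempty (H ≃* FreeGroup (Fin 2)) := by
  obtain ⟨ξ, hξ0, hξ⟩ := exists_isLimitRoot cs (J := J) fun hfin =>
    (canonicalForm_self_nonneg_of_finite hfin h.apply_eq_zero).not_gt h.neg
  obtain ⟨i, hi, hξi⟩ := h.exists_ne_zero (fun _ => hξ.apply_eq_zero) hξ0
  have hself := canonicalForm_simpleRoot_self M i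
  set η := (canonicalForm M).unitReflection (simpleRoot i) ξ with hη
  have hηlim : IsLimitRoot M J η := hξ.reflect hi
  have hηi : canonicalForm M η (simpleRoot i) = -canonicalForm M ξ (simpleRoot i) := by
    simp only [hη, unitReflection_apply, map_sub, map_smul, LinearMap.sub_apply,
      LinearMap.smul_apply, smul_eq_mul, hself]
    ring
  have hne : ξ + η ≠ 0 := by
    intro h0
    have h1 : canonicalForm M ξ (ξ + η) = 0 := by rw [h0, map_zero]
    simp only [hη, unitReflection_apply, map_add, map_sub, map_smul, hξ.canonicalForm_self,
      smul_eq_mul] at h1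
    have : 0 < canonicalForm M ξ (simpleRoot i) ^ 2 := by positivity
    linarith
  obtain ⟨j, hj, hxj⟩ := h.exists_ne_zero
    (fun k hk => by simp [hξ.apply_eq_zero hk, hηlim.apply_eq_zero hk]) hne
  have hij : i ≠ j := by
    rintro rfl
    simp [hηi] at hxj
  by_cases hξj : canonicalForm M ξ (simpleRoot j) = 0
  · refine h.exists_freeGroup_of_ne_zero cs hηlim hi hj hij (by rwa [hηi, neg_ne_zero]) ?_
    simpa [hξj] using hxj
  · exact h.exists_freeGroup_of_ne_zero cs hξ hi hj hij hξi hξj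

end IsMinimalNegative

end Indefinite

section CosFinite

theorem isIntegral_two_mul_cos {θ : ℝ} {N : ℕ} (hN : N ≠ 0) (h : Real.cos (N * θ) = 1) :
    IsIntegral ℤ (2 * Real.cos θ) := by
  rw [← isIntegral_algebraMap_iff (B := ℂ) (algebraMap ℝ ℂ).injective]
  obtain ⟨n, hn⟩ := (Real.cos_eq_one_iff _).mp h
  have hn' : (N : ℂ) * θ = n * (2 * Real.pi) := by exact_mod_cast hn.symm
  have hpow : ∀ z : ℂ, z ^ N = 1 → IsIntegral ℤ z := fun z hz =>
    IsIntegral.of_pow (Nat.pos_of_ne_zero hN) (hz ▸ isIntegral_one)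
  have h1 : Complex.exp (θ * Complex.I) ^ N = 1 := by
    rw [← Complex.exp_nat_mul, ← mul_assoc, hn', Complex.exp_eq_one_iff]
    exact ⟨n, by ring⟩
  have h2 : Complex.exp (-θ * Complex.I) ^ N = 1 := by
    rw [neg_mul, Complex.exp_neg, inv_pow, h1, inv_one]
  have h3 : algebraMap ℝ ℂ (2 * Real.cos θ) =
      Complex.exp (θ * Complex.I) + Complex.exp (-θ * Complex.I) := by
    simp [Complex.cos, mul_div_cancel₀]
  rw [h3]
  exact (hpow _ h1).add (hpow _ h2)

theorem norm_le_two_of_eval_chebyshev_eq_two {N : ℕ} (hN : N ≠ 0) {z : ℂ}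
    (hz : (Polynomial.Chebyshev.C ℂ N).eval z = 2) : ‖z‖ ≤ 2 := by
  obtain ⟨w, hw⟩ := Complex.cos_surjective (z / 2)
  obtain rfl : z = 2 * Complex.cos w := by rw [hw]; ring
  rw [Polynomial.Chebyshev.C_two_mul_complex_cos] at hz
  have h1 : Complex.cos ((N : ℤ) * w) = 1 := by linear_combination hz / 2
  obtain ⟨n, hn⟩ := Complex.cos_eq_one_iff.mp h1
  have hN' : (N : ℂ) ≠ 0 := by exact_mod_cast hN
  have h2 : w = ((n * (2 * Real.pi) / N : ℝ) : ℂ) := by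
    push_cast
    rw [eq_div_iff hN', hn]
    push_cast
    ring
  rw [h2, ← Complex.ofReal_cos, norm_mul, Complex.norm_real, Complex.norm_two, Real.norm_eq_abs]
  linarith [Real.abs_cos_le_one (n * (2 * Real.pi) / N)]

/-- A number field contains only finitely many cosines of rational angles. -/
theorem finite_setOf_cos_mem (K : IntermediateField ℚ ℝ) [FiniteDimensional ℚ K] :
    {x : ℝ | x ∈ K ∧ ∃ (N : ℕ) (θ : ℝ), N ≠ 0 ∧ x = Real.cos θ ∧ Real.cos (N * θ) = 1}.Finite := by
  have : NumberField K := { to_charZero := inferInstance, to_finiteDimensional := inferInstance }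
  refine ((NumberField.Embeddings.finite_of_norm_le K ℂ 2).image
    fun y : K => (y : ℝ) / 2).subset ?_
  rintro _ ⟨hK, N, θ, hN, rfl, h⟩
  have h2 : 2 * Real.cos θ ∈ K := mul_mem (ofNat_mem K 2) hK
  refine ⟨⟨2 * Real.cos θ, h2⟩, ⟨?_, fun φ => ?_⟩, by simp⟩
  · rw [← isIntegral_algebraMap_iff (B := ℝ) (algebraMap K ℝ).injective]
    exact isIntegral_two_mul_cos hN h
  · apply norm_le_two_of_eval_chebyshev_eq_two hN
    have h3 : (Polynomial.Chebyshev.C K N).eval ⟨2 * Real.cos θ, h2⟩ = 2 := by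
      apply (algebraMap K ℝ).injective
      rw [Polynomial.Chebyshev.algebraMap_eval_C]
      change (Polynomial.Chebyshev.C ℝ N).eval (2 * Real.cos θ) = _
      rw [Polynomial.Chebyshev.C_two_mul_real_cos, Int.cast_natCast, h, mul_one]
      exact (map_ofNat (algebraMap K ℝ) 2).symm
    have h4 := congrArg φ h3
    rw [← Polynomial.eval_map_apply, Polynomial.Chebyshev.map_C] at h4
    exact h4.trans (map_ofNat φ 2)

end CosFinite

section Semidefinite

variable {B : Type*} [Fintype B] [DecidableEq B] {M : CoxeterMatrix B}

/-- A number field containing the values of the form on roots. -/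
noncomputable def cosField (M : CoxeterMatrix B) : IntermediateField ℚ ℝ :=
  IntermediateField.adjoin ℚ (Set.range fun p : B × B => Real.cos (Real.pi / M p.1 p.2))

instance finiteDimensional_cosField : FiniteDimensional ℚ (cosField M) := by
  apply IntermediateField.finiteDimensional_adjoin
  rintro _ ⟨⟨i, j⟩, rfl⟩
  have h : IsIntegral ℤ (2 * Real.cos (Real.pi / M i j)) := by
    by_cases h0 : M i j = 0
    · exact isIntegral_two_mul_cos one_ne_zero (by simp [h0])
    · refine isIntegral_two_mul_cos (N := 2 * M i j) (by lia) ?_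
      have : ((2 * M i j : ℕ) : ℝ) * (Real.pi / M i j) = 2 * Real.pi := by
        push_cast
        field_simp
      rw [this, Real.cos_two_pi]
  have h2 : Real.cos (Real.pi / M i j) =
      algebraMap ℚ ℝ 2⁻¹ * (2 * Real.cos (Real.pi / M i j)) := by simp
  change IsIntegral ℚ (Real.cos (Real.pi / M i j))
  rw [h2]
  exact isIntegral_algebraMap.mul h.tower_top

variable {α β : B → ℝ} {J : Set B}

theorem canonicalForm_mem_cosField {v w : B → ℝ} (hv : ∀ i, v i ∈ cosField M)
    (hw : ∀ i, w i ∈ cosField M) : canonicalForm M v w ∈ cosField M := by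
  rw [canonicalForm_eq_sum]
  refine sum_mem fun i _ => mul_mem (hv i) ?_
  rw [canonicalForm_comm, canonicalForm_eq_sum]
  refine sum_mem fun j _ => mul_mem (hw j) ?_
  rw [canonicalForm_simpleRoot]
  exact neg_mem (IntermediateField.subset_adjoin _ _ ⟨(j, i), rfl⟩)

theorem IsRoot.mem_cosField (h : IsRoot M J α) (k : B) : α k ∈ cosField M := by
  have hs : ∀ i l : B, simpleRoot i l ∈ cosField M := by
    intro i l
    rw [simpleRoot, Pi.single_apply]
    split_ifs
    exacts [one_mem _, zero_mem _]
  induction h generalizing k with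
  | simple _ => exact hs _ k
  | @reflect j α _ _ ih =>
    rw [unitReflection_apply, Pi.sub_apply, Pi.smul_apply, smul_eq_mul]
    exact sub_mem (ih k) (mul_mem (mul_mem (ofNat_mem _ 2)
      (canonicalForm_mem_cosField ih (hs j))) (hs j k))

variable {W : Type*} [Group W] (cs : CoxeterSystem M W)

/-- The subgroup of elements acting trivially modulo a subspace. -/
def displacementSubgroup (U : Submodule ℝ (B → ℝ)) : Subgroup W where
  carrier := {w | ∀ v, geometricRep cs w v - v ∈ U}
  one_mem' v := by simp
  mul_mem' {w w'} hw hw' v := by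
    have := U.add_mem (hw (geometricRep cs w' v)) (hw' v)
    rwa [sub_add_sub_cancel, ← Module.End.mul_apply, ← map_mul] at this
  inv_mem' {w} hw v := by
    have := U.neg_mem (hw (geometricRep cs w⁻¹ v))
    rwa [neg_sub, ← Module.End.mul_apply, ← map_mul, mul_inv_cancel, map_one,
      Module.End.one_apply] at this

theorem mem_displacementSubgroup {U : Submodule ℝ (B → ℝ)} {w : W} :
    w ∈ displacementSubgroup cs U ↔ ∀ v, geometricRep cs w v - v ∈ U := Iff.rfl

variable (hpsd : ∀ v, 0 ≤ canonicalForm M v v)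

include hpsd

theorem abs_canonicalForm_root_le_one (hα : IsRoot M J α) (hβ : IsRoot M J β) :
    |canonicalForm M α β| ≤ 1 := by
  have h1 := hpsd (α + β)
  have h2 := hpsd (α - β)
  simp only [map_add, map_sub, LinearMap.add_apply, LinearMap.sub_apply, hα.canonicalForm_self,
    hβ.canonicalForm_self, canonicalForm_comm M β α] at h1 h2
  rw [abs_le]
  constructor <;> linarith

theorem finite_displacementSubgroup_span_pair (hα : IsRoot M J α) (hβ : IsRoot M J β)
    (hlt : |canonicalForm M α β| < 1) :
    (displacementSubgroup cs (Submodule.span ℝ {α, β}) : Set W).Finite := by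
  set b := canonicalForm M α β with hb
  set R := √(4 / (1 - |b|)) with hR
  have hbound : ∀ w ∈ displacementSubgroup cs (Submodule.span ℝ {α, β}), ∀ i,
      ‖geometricRep cs w (simpleRoot i)‖ ≤ R * ‖α‖ + R * ‖β‖ + 1 := by
    intro w hw i
    obtain ⟨p, q, hpq⟩ := Submodule.mem_span_pair.mp (hw (simpleRoot i))
    have h1 := hpsd (geometricRep cs w (simpleRoot i) + simpleRoot i)
    have h2 : canonicalForm M (p • α + q • β) (p • α + q • β) ≤ 4 := by
      rw [hpq]
      simp only [map_add, map_sub, LinearMap.add_apply, LinearMap.sub_apply,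
        geometricRep_isometry, canonicalForm_simpleRoot_self] at h1 ⊢
      linarith
    simp only [map_add, map_smul, LinearMap.add_apply, LinearMap.smul_apply, smul_eq_mul,
      hα.canonicalForm_self, hβ.canonicalForm_self, canonicalForm_comm M β α, ← hb] at h2
    have h3 : (1 - |b|) * (p ^ 2 + q ^ 2) ≤ 4 := by
      have h4 : -(2 * (p * q * b)) ≤ |b| * (p ^ 2 + q ^ 2) := by
        rcases abs_cases b with ⟨h, _⟩ | ⟨h, _⟩ <;> rw [h] <;>
          nlinarith [sq_nonneg (p + q), sq_nonneg (p - q)]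
      linarith
    have h5 : p ^ 2 + q ^ 2 ≤ 4 / (1 - |b|) := by
      rw [le_div_iff₀ (by linarith)]
      linarith
    have hp : |p| ≤ R := Real.abs_le_sqrt (by linarith [sq_nonneg q])
    have hq : |q| ≤ R := Real.abs_le_sqrt (by linarith [sq_nonneg p])
    have h6 : geometricRep cs w (simpleRoot i) = p • α + q • β + simpleRoot i := by
      rw [hpq, sub_add_cancel]
    rw [h6]
    refine (norm_add₃_le).trans ?_
    rw [norm_smul, norm_smul, norm_simpleRoot, Real.norm_eq_abs, Real.norm_eq_abs]
    gcongr
  exact finite_of_norm_geometricRep_le cs hbound fun w hw => hbound _ (inv_mem hw)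

include cs

/-- Roots meet at rational angles if the form is positive semidefinite. -/
theorem exists_canonicalForm_root_eq_neg_cos (hα : IsRoot M J α) (hβ : IsRoot M J β) :
    ∃ (N : ℕ) (θ : ℝ), N ≠ 0 ∧ -canonicalForm M α β = Real.cos θ ∧ Real.cos (N * θ) = 1 := by
  have hle := abs_canonicalForm_root_le_one hpsd hα hβ
  rcases hle.eq_or_lt with h1 | hlt
  · rcases (abs_eq zero_le_one).mp h1 with h | h
    · exact ⟨2, Real.pi, two_ne_zero, by simp [h], by simp⟩
    · exact ⟨1, 0, one_ne_zero, by simp [h], by simp⟩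
  obtain ⟨t, -, ht⟩ := hα.exists_reflection cs
  obtain ⟨u, -, hu⟩ := hβ.exists_reflection cs
  have htmem : t ∈ displacementSubgroup cs (Submodule.span ℝ {α, β}) := by
    intro v
    rw [ht, unitReflection_apply, sub_sub_cancel_left]
    exact neg_mem (Submodule.smul_mem _ _ (Submodule.subset_span (by simp)))
  have humem : u ∈ displacementSubgroup cs (Submodule.span ℝ {α, β}) := by
    intro v
    rw [hu, unitReflection_apply, sub_sub_cancel_left]
    exact neg_mem (Submodule.smul_mem _ _ (Submodule.subset_span (by simp)))
  have hfin : IsOfFinOrder (t * u) := by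
    rw [← finite_zpowers]
    exact (finite_displacementSubgroup_span_pair cs hpsd hα hβ hlt).subset
      (SetLike.coe_subset_coe.mpr (Subgroup.zpowers_le.mpr (mul_mem htmem humem)))
  obtain ⟨d, hd, hpow⟩ := isOfFinOrder_iff_pow_eq_one.mp hfin
  have hbound := abs_le.mp hle
  set θ := Real.arccos (-canonicalForm M α β) with hθ
  have hcos : Real.cos θ = -canonicalForm M α β :=
    Real.cos_arccos (by linarith) (by linarith)
  have h2 := pow_rotation_left (canonicalForm_isSymm M) hα.canonicalForm_self
    hβ.canonicalForm_self (θ := θ) (by rw [hcos, neg_neg]) d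
  rw [← ht, ← hu, ← map_mul, ← map_pow, hpow, map_one, Module.End.one_apply] at h2
  have h3 := congrArg (canonicalForm M α) h2
  have h4 := congrArg (canonicalForm M β) h2
  simp only [map_add, map_smul, smul_eq_mul, hα.canonicalForm_self, hβ.canonicalForm_self,
    canonicalForm_comm M β α] at h3 h4
  have h5 : Real.sin (2 * d * θ) * (1 - canonicalForm M α β ^ 2) = 0 := by
    linear_combination canonicalForm M α β * h3 - h4
  have h6 : 1 - canonicalForm M α β ^ 2 ≠ 0 := by
    have := (sq_lt_one_iff_abs_lt_one _).mpr hlt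
    linarith
  have h7 := (mul_eq_zero.mp h5).resolve_right h6
  refine ⟨2 * (2 * d), θ, by lia, hcos.symm, ?_⟩
  have h8 : ((2 * (2 * d) : ℕ) : ℝ) * θ = 2 * (2 * d * θ) := by push_cast; ring
  rw [h8, Real.cos_two_mul, Real.cos_sq', h7]
  norm_num

theorem finite_canonicalForm_root :
    {x | ∃ α β, IsRoot M J α ∧ IsRoot M J β ∧ canonicalForm M α β = x}.Finite := by
  refine ((finite_setOf_cos_mem (cosField M)).image Neg.neg).subset ?_
  rintro _ ⟨α, β, hα, hβ, rfl⟩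
  obtain ⟨N, θ, hN, h1, h2⟩ := exists_canonicalForm_root_eq_neg_cos cs hpsd hα hβ
  exact ⟨-canonicalForm M α β, ⟨neg_mem (canonicalForm_mem_cosField hα.mem_cosField
    hβ.mem_cosField), N, θ, hN, h1, h2⟩, neg_neg _⟩

theorem finiteIndex_displacementSubgroup_ker :
    (displacementSubgroup cs (LinearMap.ker (canonicalForm M))).FiniteIndex := by
  have hfin := finite_canonicalForm_root (J := Set.univ) cs hpsd
  have := hfin.to_subtype
  let F : W → B → B → {x | ∃ α β, IsRoot M Set.univ α ∧ IsRoot M Set.univ β ∧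
      canonicalForm M α β = x} := fun w i j =>
    ⟨canonicalForm M (geometricRep cs w (simpleRoot i)) (simpleRoot j),
      _, _, isRoot_geometricRep cs w i, .simple (Set.mem_univ j), rfl⟩
  have hF : ∀ w w', F w = F w' →
      w⁻¹ * w' ∈ displacementSubgroup cs (LinearMap.ker (canonicalForm M)) := by
    intro w w' h v
    have h1 : ∀ i j, canonicalForm M (geometricRep cs w (simpleRoot i)) (simpleRoot j) =
        canonicalForm M (geometricRep cs w' (simpleRoot i)) (simpleRoot j) := fun i j =>
      congrArg Subtype.val (congrFun (congrFun h i) j)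
    have h2 : ∀ v u, canonicalForm M (geometricRep cs w v) u =
        canonicalForm M (geometricRep cs w' v) u := by
      intro v u
      rw [eq_sum_simpleRoot v, eq_sum_simpleRoot u]
      simp [h1]
    rw [LinearMap.mem_ker]
    refine LinearMap.ext fun u => ?_
    have h3 := h2 v (geometricRep cs w u)
    rw [geometricRep_isometry] at h3
    rw [LinearMap.zero_apply, map_sub, LinearMap.sub_apply, h3, map_mul, Module.End.mul_apply,
      ← geometricRep_isometry cs w, ← Module.End.mul_apply (geometricRep cs w), ← map_mul,
      mul_inv_cancel, map_one, Module.End.one_apply, sub_self]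
  have : Finite (W ⧸ displacementSubgroup cs (LinearMap.ker (canonicalForm M))) := by
    apply Finite.of_injective fun q => F q.out
    intro q q' h
    have := QuotientGroup.eq.mpr (hF _ _ h)
    rwa [QuotientGroup.out_eq', QuotientGroup.out_eq'] at this
  exact Subgroup.finiteIndex_of_finite_quotient

omit hpsd

theorem geometricRep_apply_of_mem_ker (w : W) {v : B → ℝ}
    (hv : v ∈ LinearMap.ker (canonicalForm M)) : geometricRep cs w v = v := by
  induction w using cs.simple_induction_left with
  | one => simp
  | mul_simple_left w i ih =>
    rw [map_mul, Module.End.mul_apply, ih, geometricRep_simple, unitReflection_apply,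
      LinearMap.mem_ker.mp hv]
    simp

theorem commute_of_mem_displacementSubgroup_ker {a b : W}
    (ha : a ∈ displacementSubgroup cs (LinearMap.ker (canonicalForm M)))
    (hb : b ∈ displacementSubgroup cs (LinearMap.ker (canonicalForm M))) : a * b = b * a := by
  apply geometricRep_injective cs
  refine LinearMap.ext fun v => ?_
  have h1 := geometricRep_apply_of_mem_ker cs a (hb v)
  have h2 := geometricRep_apply_of_mem_ker cs b (ha v)
  rw [map_sub] at h1 h2
  rw [map_mul, map_mul, Module.End.mul_apply, Module.End.mul_apply]
  linear_combination h1 - h2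

end Semidefinite

end CoxeterTits

/-- **Tits alternative for Coxeter groups.**
Let `(W, S)` be a Coxeter system with `S` finite.  Then `W` contains no subgroup isomorphic
to the free group on two generators if and only if `W` is virtually abelian (i.e. `W` has an
abelian subgroup of finite index). -/
theorem coxeter_no_free_iff_virtually_abelian {B : Type*} [Fintype B] {W : Type*} [Group W]
    {M : CoxeterMatrix B} (cs : CoxeterSystem M W) :
    (¬ ∃ H : Subgroup W, Nonempty (H ≃* FreeGroup (Fin 2))) ↔
      ∃ H : Subgroup W, H.FiniteIndex ∧ ∀ a ∈ H, ∀ b ∈ H, a * b = b * a := by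
  classical
  refine ⟨fun hfree => ?_, fun ⟨H, hH, hab⟩ =>
    CoxeterTits.not_exists_freeGroup_of_finiteIndex hH hab⟩
  have hpsd : ∀ v, 0 ≤ CoxeterTits.canonicalForm M v v := by
    by_contra! hneg
    obtain ⟨z, hz⟩ := hneg
    obtain ⟨J, z, h⟩ := CoxeterTits.exists_isMinimalNegative hz
    exact hfree (h.exists_freeGroup cs)
  exact ⟨_, CoxeterTits.finiteIndex_displacementSubgroup_ker cs hpsd, fun a ha b hb =>
    CoxeterTits.commute_of_mem_displacementSubgroup_ker cs ha hb⟩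
end
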